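/- Let ε > 0 and γ ∈ (0,1) be arbitrary. There exists a constant C > 0 such that for all α ∈ (0,1) there is Δ₀ ∈ ℕ with the following property. Let Δ ≥ Δ₀, n ∈ ℕ, and let k and q ≥ s satisfy 1 ≤ k ≤ Δ^{2αγ}, q = 4(1+γ+ε)Δ / log(Δ^α/√k), and s ≥ Δ^α + C√(log n). Let G = (V,E) be an n-vertex k-locally-sparse graph of maximum degree Δ. Suppose for each vertex v ∈ V, a set L(v) ⊆ [q] of size s is sampled independently and uniformly at random. Then with probability at least 1 − 1/n there exists a proper coloring φ of G such that φ(v) ∈ L(v) for each v ∈ V. -/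

import Mathlib

open Finset

attribute [local instance] Classical.propDecidable

noncomputable section

/-- The number of ordered pairs of adjacent vertices inside `S`; this is exactly twice the
number of edges of the subgraph induced on `S`. -/
def pairsWithin {V : Type} [Fintype V] (G : SimpleGraph V) (S : Finset V) : ℕ :=
  ((S ×ˢ S).filter fun p => G.Adj p.1 p.2).card

/-- `G` is `k`-locally-sparse: each neighborhood induces at most `k` edges. -/
def LocallySparse {V : Type} [Fintype V] (G : SimpleGraph V) (k : ℝ) : Prop :=
  ∀ v : V, (pairsWithin G (G.neighborFinset v) : ℝ) ≤ 2 * k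


/-- expectation over a finite product space -/
def Ex {ι α : Type} [Fintype ι] [Fintype α] (w : ι → α → ℝ) (f : (ι → α) → ℝ) : ℝ :=
  ∑ ω, (∏ i, w i (ω i)) * f ω

/-- indicator -/
def ind (P : Prop) : ℝ := @ite ℝ P (Classical.propDecidable P) 1 0

lemma ind_true {P : Prop} (h : P) : ind P = 1 := if_pos h
lemma ind_false {P : Prop} (h : ¬ P) : ind P = 0 := if_neg h
lemma ind_nonneg (P : Prop) : 0 ≤ ind P := by
  by_cases h : P
  · rw [ind_true h]; norm_num
  · rw [ind_false h]
lemma ind_le_one (P : Prop) : ind P ≤ 1 := by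
  by_cases h : P
  · rw [ind_true h]
  · rw [ind_false h]; norm_num
lemma ind_congr {P Q : Prop} (h : P ↔ Q) : ind P = ind Q := by rw [propext h]
lemma ind_mono {P Q : Prop} (h : P → Q) : ind P ≤ ind Q := by
  by_cases hp : P
  · rw [ind_true hp, ind_true (h hp)]
  · rw [ind_false hp]; exact ind_nonneg Q
lemma ind_and (P Q : Prop) : ind (P ∧ Q) = ind P * ind Q := by
  by_cases hp : P <;> by_cases hq : Q <;> simp [ind, hp, hq]
lemma ind_not (P : Prop) : ind (¬ P) = 1 - ind P := by
  by_cases hp : P <;> simp [ind, hp]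

/-- probability over a finite product space -/
def Pr {ι α : Type} [Fintype ι] [Fintype α] (w : ι → α → ℝ) (A : (ι → α) → Prop) : ℝ :=
  Ex w (fun ω => ind (A ω))

/-- weights are probability weights -/
structure IsW {ι α : Type} [Fintype ι] [Fintype α] (w : ι → α → ℝ) : Prop where
  nonneg : ∀ i a, 0 ≤ w i a
  sum_one : ∀ i, ∑ a, w i a = 1

section basics
variable {ι α : Type} [Fintype ι] [Fintype α] {w : ι → α → ℝ}

lemma IsW.prod_nonneg (hw : IsW w) (ω : ι → α) : 0 ≤ ∏ i, w i (ω i) :=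
  Finset.prod_nonneg fun i _ => hw.nonneg i _

lemma Ex_prod (g : ι → α → ℝ) :
    Ex w (fun ω => ∏ i, g i (ω i)) = ∏ i, ∑ a, w i a * g i a := by
  unfold Ex
  rw [Finset.prod_univ_sum]
  simp only [← Finset.prod_mul_distrib, Fintype.piFinset_univ]

lemma Ex_const (hw : IsW w) (c : ℝ) : Ex w (fun _ => c) = c := by
  have h := Ex_prod (w := w) (fun _ _ => (1:ℝ))
  simp only [Finset.prod_const_one, mul_one, hw.sum_one] at h
  unfold Ex at *
  rw [← Finset.sum_mul]
  simp only [mul_one] at h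
  rw [h, one_mul]

lemma Ex_mono (hw : IsW w) {f g : (ι → α) → ℝ} (h : ∀ ω, f ω ≤ g ω) : Ex w f ≤ Ex w g :=
  Finset.sum_le_sum fun ω _ => mul_le_mul_of_nonneg_left (h ω) (hw.prod_nonneg ω)

lemma Ex_add (f g : (ι → α) → ℝ) : Ex w (fun ω => f ω + g ω) = Ex w f + Ex w g := by
  unfold Ex; simp only [mul_add, Finset.sum_add_distrib]

lemma Ex_smul (c : ℝ) (f : (ι → α) → ℝ) : Ex w (fun ω => c * f ω) = c * Ex w f := by
  unfold Ex; rw [Finset.mul_sum]; exact Finset.sum_congr rfl fun ω _ => by ring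

lemma Ex_sum {κ : Type} (s : Finset κ) (f : κ → (ι → α) → ℝ) :
    Ex w (fun ω => ∑ j ∈ s, f j ω) = ∑ j ∈ s, Ex w (f j) := by
  unfold Ex; simp only [Finset.mul_sum]; exact Finset.sum_comm

lemma Ex_nonneg (hw : IsW w) {f : (ι → α) → ℝ} (h : ∀ ω, 0 ≤ f ω) : 0 ≤ Ex w f :=
  Finset.sum_nonneg fun ω _ => mul_nonneg (hw.prod_nonneg ω) (h ω)

lemma Pr_nonneg (hw : IsW w) (A : (ι → α) → Prop) : 0 ≤ Pr w A :=
  Ex_nonneg hw fun ω => ind_nonneg _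

lemma Pr_mono (hw : IsW w) {A B : (ι → α) → Prop} (h : ∀ ω, A ω → B ω) : Pr w A ≤ Pr w B :=
  Ex_mono hw fun ω => ind_mono (h ω)

lemma Pr_or (hw : IsW w) (A B : (ι → α) → Prop) :
    Pr w (fun ω => A ω ∨ B ω) ≤ Pr w A + Pr w B := by
  unfold Pr; rw [← Ex_add]
  refine Ex_mono hw fun ω => ?_
  by_cases hA : A ω <;> by_cases hB : B ω <;> simp [hA, hB, ind]

lemma Pr_exists (hw : IsW w) {κ : Type} (s : Finset κ) (A : κ → (ι → α) → Prop) :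
    Pr w (fun ω => ∃ j ∈ s, A j ω) ≤ ∑ j ∈ s, Pr w (A j) := by
  unfold Pr; rw [← Ex_sum]
  refine Ex_mono hw fun ω => ?_
  by_cases h : ∃ j ∈ s, A j ω
  · obtain ⟨j, hj, hA⟩ := h
    rw [ind_true ⟨j, hj, hA⟩, ← ind_true hA]
    exact Finset.single_le_sum (f := fun j => ind (A j ω)) (fun i _ => ind_nonneg _) hj
  · rw [ind_false h]; exact Finset.sum_nonneg fun i _ => ind_nonneg _

lemma Ex_update (hw : IsW w) (i : ι) (f : (ι → α) → ℝ) :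
    Ex w f = Ex w (fun ω => ∑ a, w i a * f (Function.update ω i a)) := by
  unfold Ex
  simp only [Finset.mul_sum]
  rw [← Finset.sum_product' (s := univ) (t := univ)
    (f := fun ω a => (∏ j, w j (ω j)) * (w i a * f (Function.update ω i a)))]
  have key : ∀ (ω : ι → α) (a : α),
      (∏ j, w j (Function.update ω i a j)) * w i (ω i) = (∏ j, w j (ω j)) * w i a := by
    intro ω a
    rw [← Finset.mul_prod_erase univ _ (mem_univ i), ← Finset.mul_prod_erase univ
      (fun j => w j (ω j)) (mem_univ i)]
    have : ∏ j ∈ univ.erase i, w j (Function.update ω i a j) = ∏ j ∈ univ.erase i, w j (ω j) := by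
      refine Finset.prod_congr rfl fun j hj => ?_
      rw [Function.update_of_ne (Finset.ne_of_mem_erase hj)]
    rw [this, Function.update_self]; ring
  have e : ∑ x ∈ (univ : Finset (ι → α)) ×ˢ (univ : Finset α),
      (∏ j, w j (x.1 j)) * (w i x.2 * f (Function.update x.1 i x.2))
      = ∑ x ∈ (univ : Finset (ι → α)) ×ˢ (univ : Finset α),
      (∏ j, w j (x.1 j)) * (w i x.2 * f x.1) := by
    refine Finset.sum_bij' (fun x _ => (Function.update x.1 i x.2, x.1 i))
      (fun x _ => (Function.update x.1 i x.2, x.1 i)) ?_ ?_ ?_ ?_ ?_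
    · intros; simp
    · intros; simp
    · rintro ⟨ω, a⟩ _; simp
    · rintro ⟨ω, a⟩ _; simp
    · rintro ⟨ω, a⟩ _
      dsimp only
      rw [← mul_assoc, ← mul_assoc, key]
  rw [e, Finset.sum_product]
  refine Finset.sum_congr rfl fun ω _ => ?_
  dsimp only
  rw [← Finset.mul_sum, ← Finset.sum_mul, hw.sum_one, one_mul]

/-- exponential supermartingale -/
lemma mart (hw : IsW w) (r : ι → ℕ) (Z : ι → (ι → α) → ℝ) : ∀ (S : Finset ι),
    Set.InjOn r S →
    (∀ i ∈ S, ∀ m ∈ S, r i < r m → ∀ ω a, Z i (Function.update ω m a) = Z i ω) →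
    (∀ m ∈ S, ∀ ω, ∑ a, w m a * Real.exp (Z m (Function.update ω m a)) ≤ 1) →
    Ex w (fun ω => Real.exp (∑ i ∈ S, Z i ω)) ≤ 1 := by
  intro S
  induction S using Finset.strongInduction with
  | H S ih =>
    intro hinj hdep hexp
    rcases S.eq_empty_or_nonempty with rfl | hne
    · simp [Ex_const hw]
    obtain ⟨m, hm, hmax⟩ := Finset.exists_max_image S r hne
    rw [Ex_update hw m]
    refine le_trans (Ex_mono hw (g := fun ω => Real.exp (∑ i ∈ S.erase m, Z i ω)) ?_)
      (ih (S.erase m) (Finset.erase_ssubset hm)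
        (hinj.mono (by intro x hx; exact Finset.mem_of_mem_erase hx))
        (fun i hi j hj => hdep i (Finset.mem_of_mem_erase hi) j (Finset.mem_of_mem_erase hj))
        (fun j hj => hexp j (Finset.mem_of_mem_erase hj)))
    intro ω
    have h1 : ∀ a, w m a * Real.exp (∑ i ∈ S, Z i (Function.update ω m a))
        = Real.exp (∑ i ∈ S.erase m, Z i ω) *
          (w m a * Real.exp (Z m (Function.update ω m a))) := by
      intro a
      rw [← Finset.add_sum_erase S _ hm, Real.exp_add]
      have : ∑ i ∈ S.erase m, Z i (Function.update ω m a) = ∑ i ∈ S.erase m, Z i ω := by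
        refine Finset.sum_congr rfl fun i hi => ?_
        have hi' := Finset.mem_of_mem_erase hi
        refine hdep i hi' m hm (lt_of_le_of_ne (hmax i hi') ?_) ω a
        intro h
        exact Finset.ne_of_mem_erase hi (hinj hi' hm h)
      rw [this]; ring
    simp only [h1]
    rw [← Finset.mul_sum]
    exact mul_le_of_le_one_right (Real.exp_pos _).le (hexp m hm ω)

lemma Pr_exp (hw : IsW w) {f : (ι → α) → ℝ} (h : Ex w (fun ω => Real.exp (f ω)) ≤ 1) (y : ℝ) :
    Pr w (fun ω => y ≤ f ω) ≤ Real.exp (-y) := by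
  have : Pr w (fun ω => y ≤ f ω) ≤ Ex w (fun ω => Real.exp (-y) * Real.exp (f ω)) := by
    refine Ex_mono hw fun ω => ?_
    rw [← Real.exp_add]
    by_cases h : y ≤ f ω
    · rw [ind_true h, ← Real.exp_zero]; exact Real.exp_le_exp.2 (by linarith)
    · rw [ind_false h]; exact (Real.exp_pos _).le
  rw [Ex_smul] at this
  exact this.trans (mul_le_of_le_one_right (Real.exp_pos _).le h)

lemma exp_quad {x : ℝ} (h : |x| ≤ 1) : Real.exp x ≤ 1 + x + x ^ 2 := by
  have := Real.abs_exp_sub_one_sub_id_le h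
  have := (abs_le.1 this).2
  linarith

lemma tail_upper (hw : IsW w) (r : ι → ℕ) (S : Finset ι) (hinj : Set.InjOn r S)
    (X h : ι → (ι → α) → ℝ) (m θ y : ℝ) (hθ : 0 ≤ θ) (hθm : θ * m ≤ 1)
    (hX0 : ∀ i ∈ S, ∀ ω, 0 ≤ X i ω) (hXm : ∀ i ∈ S, ∀ ω, X i ω ≤ m)
    (hXdep : ∀ i ∈ S, ∀ j ∈ S, r i < r j → ∀ ω a, X i (Function.update ω j a) = X i ω)
    (hhdep : ∀ i ∈ S, ∀ j ∈ S, r i ≤ r j → ∀ ω a, h i (Function.update ω j a) = h i ω)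
    (hE : ∀ i ∈ S, ∀ ω, ∑ a, w i a * X i (Function.update ω i a) ≤ h i ω) :
    Pr w (fun ω => (1 + θ * m) * ∑ i ∈ S, h i ω + y ≤ ∑ i ∈ S, X i ω) ≤ Real.exp (-(θ * y)) := by
  refine le_trans ?_ (Pr_exp hw (mart hw r (fun i ω => θ * X i ω - θ * (1 + θ * m) * h i ω)
    S hinj ?_ ?_) (θ * y))
  · refine Pr_mono hw fun ω hω => ?_
    rw [Finset.sum_sub_distrib, ← Finset.mul_sum, ← Finset.mul_sum]
    have := mul_le_mul_of_nonneg_left hω hθ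
    linarith
  · intro i hi j hj hij ω a
    rw [hXdep i hi j hj hij, hhdep i hi j hj hij.le]
  · intro i hi ω
    have h1 : ∀ a, w i a * Real.exp (θ * X i (Function.update ω i a)
        - θ * (1 + θ * m) * h i (Function.update ω i a))
        ≤ Real.exp (- (θ * (1 + θ * m) * h i ω)) *
          (w i a * 1 + θ * (1 + θ * m) * (w i a * X i (Function.update ω i a))) := by
      intro a
      rw [hhdep i hi i hi le_rfl, sub_eq_add_neg, Real.exp_add]
      have hx0 := hX0 i hi (Function.update ω i a)
      have hxm := hXm i hi (Function.update ω i a)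
      set x := X i (Function.update ω i a)
      have h2 : Real.exp (θ * x) ≤ 1 + θ * (1 + θ * m) * x := by
        have : θ * x ≤ θ * m := mul_le_mul_of_nonneg_left hxm hθ
        have h0 : 0 ≤ θ * x := mul_nonneg hθ hx0
        have := exp_quad (x := θ * x) (by rw [abs_of_nonneg h0]; linarith)
        nlinarith
      have h3 := hw.nonneg i a
      have h4 := Real.exp_pos (- (θ * (1 + θ * m) * h i ω))
      calc w i a * (Real.exp (θ * x) * Real.exp (- (θ * (1 + θ * m) * h i ω)))
          ≤ w i a * ((1 + θ * (1 + θ * m) * x) * Real.exp (- (θ * (1 + θ * m) * h i ω))) := by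
            gcongr
        _ = _ := by ring
    refine (Finset.sum_le_sum fun a _ => h1 a).trans ?_
    rw [← Finset.mul_sum, Finset.sum_add_distrib, ← Finset.mul_sum, ← Finset.sum_mul,
      hw.sum_one]
    rw [Real.exp_neg, inv_mul_le_iff₀ (Real.exp_pos _), mul_one, mul_one]
    have hm0 : 0 ≤ θ * m := by
      have : Nonempty (ι → α) := ⟨ω⟩
      exact mul_nonneg hθ ((hX0 i hi ω).trans (hXm i hi ω))
    have h5 : θ * (1 + θ * m) * ∑ a, w i a * X i (Function.update ω i a)
        ≤ θ * (1 + θ * m) * h i ω :=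
      mul_le_mul_of_nonneg_left (hE i hi ω) (mul_nonneg hθ (by linarith))
    have := Real.add_one_le_exp (θ * (1 + θ * m) * h i ω)
    linarith

/-- independent version, upper tail -/
lemma tail_upper_indep (hw : IsW w) (S : Finset ι)
    (x : ι → α → ℝ) (m θ y : ℝ) (hθ : 0 ≤ θ) (hθm : θ * m ≤ 1)
    (hX0 : ∀ i ∈ S, ∀ a, 0 ≤ x i a) (hXm : ∀ i ∈ S, ∀ a, x i a ≤ m)
    (M : ι → ℝ) (hE : ∀ i ∈ S, ∑ a, w i a * x i a ≤ M i) :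
    Pr w (fun ω => (1 + θ * m) * ∑ i ∈ S, M i + y ≤ ∑ i ∈ S, x i (ω i))
      ≤ Real.exp (-(θ * y)) := by
  let r : ι → ℕ := fun i => (Fintype.equivFin ι i).1
  have hr : Function.Injective r := fun a b h => (Fintype.equivFin ι).injective (Fin.ext h)
  refine tail_upper hw r S hr.injOn (fun i ω => x i (ω i)) (fun i _ => M i) m θ y hθ hθm
    (fun i hi ω => hX0 i hi _) (fun i hi ω => hXm i hi _) ?_ (fun _ _ _ _ _ _ _ => rfl) ?_
  · intro i _ j _ hij ω a
    rw [Function.update_of_ne]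
    rintro rfl; exact lt_irrefl _ hij
  · intro i hi ω
    simpa using hE i hi

/-- independent version, lower tail -/
lemma tail_lower_indep (hw : IsW w) (S : Finset ι)
    (x : ι → α → ℝ) (m θ y : ℝ) (hθ : 0 ≤ θ) (hθm : θ * m ≤ 1)
    (hX0 : ∀ i ∈ S, ∀ a, 0 ≤ x i a) (hXm : ∀ i ∈ S, ∀ a, x i a ≤ m)
    (M : ι → ℝ) (hE : ∀ i ∈ S, M i ≤ ∑ a, w i a * x i a) :
    Pr w (fun ω => ∑ i ∈ S, x i (ω i) ≤ (1 - θ * m) * ∑ i ∈ S, M i - y)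
      ≤ Real.exp (-(θ * y)) := by
  let r : ι → ℕ := fun i => (Fintype.equivFin ι i).1
  have hr : Function.Injective r := fun a b h => (Fintype.equivFin ι).injective (Fin.ext h)
  refine le_trans ?_ (Pr_exp hw (mart hw r
    (fun i ω => - (θ * x i (ω i)) + θ * (1 - θ * m) * M i)
    S hr.injOn ?_ ?_) (θ * y))
  · refine Pr_mono hw fun ω hω => ?_
    rw [Finset.sum_add_distrib, Finset.sum_neg_distrib, ← Finset.mul_sum, ← Finset.mul_sum]
    have := mul_le_mul_of_nonneg_left hω hθ
    linarith
  · intro i _ j _ hij ω a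
    rw [Function.update_of_ne]
    rintro rfl; exact lt_irrefl _ hij
  · intro i hi ω
    simp only [Function.update_self]
    have h1 : ∀ a, w i a * Real.exp (-(θ * x i a) + θ * (1 - θ * m) * M i)
        ≤ Real.exp (θ * (1 - θ * m) * M i) *
          (w i a * 1 - θ * (1 - θ * m) * (w i a * x i a)) := by
      intro a
      rw [Real.exp_add]
      have hx0 := hX0 i hi a
      have hxm := hXm i hi a
      have h2 : Real.exp (-(θ * x i a)) ≤ 1 - θ * (1 - θ * m) * x i a := by
        have : θ * x i a ≤ θ * m := mul_le_mul_of_nonneg_left hxm hθ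
        have h0 : 0 ≤ θ * x i a := mul_nonneg hθ hx0
        have := exp_quad (x := -(θ * x i a)) (by rw [abs_neg, abs_of_nonneg h0]; linarith)
        nlinarith
      have h3 := hw.nonneg i a
      have h4 := Real.exp_pos (θ * (1 - θ * m) * M i)
      calc w i a * (Real.exp (-(θ * x i a)) * Real.exp (θ * (1 - θ * m) * M i))
          ≤ w i a * ((1 - θ * (1 - θ * m) * x i a) * Real.exp (θ * (1 - θ * m) * M i)) := by
            gcongr
        _ = _ := by ring
    refine (Finset.sum_le_sum fun a _ => h1 a).trans ?_
    rw [← Finset.mul_sum, Finset.sum_sub_distrib, ← Finset.mul_sum, ← Finset.sum_mul,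
      hw.sum_one]
    have h5 : θ * (1 - θ * m) * M i ≤ θ * (1 - θ * m) * ∑ a, w i a * x i a :=
      mul_le_mul_of_nonneg_left (hE i hi) (mul_nonneg hθ (by linarith))
    have h6 := Real.add_one_le_exp (-(θ * (1 - θ * m) * M i))
    calc Real.exp (θ * (1 - θ * m) * M i) * (1 * 1 - θ * (1 - θ * m) * ∑ a, w i a * x i a)
        ≤ Real.exp (θ * (1 - θ * m) * M i) * Real.exp (-(θ * (1 - θ * m) * M i)) := by
          gcongr; linarith
      _ = 1 := by rw [← Real.exp_add]; simp

/-- independence -/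
lemma Ex_indep (hw : IsW w) (A : Finset ι) (f g : (ι → α) → ℝ)
    (hf : ∀ ω ω', (∀ i ∈ A, ω i = ω' i) → f ω = f ω')
    (hg : ∀ ω ω', (∀ i, i ∉ A → ω i = ω' i) → g ω = g ω') :
    Ex w (fun ω => f ω * g ω) = Ex w f * Ex w g := by
  have h1 : Ex w f * Ex w g = ∑ x ∈ (univ : Finset (ι → α)) ×ˢ (univ : Finset (ι → α)),
      ((∏ i, w i (x.1 i)) * f x.1) * ((∏ i, w i (x.2 i)) * g x.2) := by
    unfold Ex; rw [Finset.sum_mul_sum, Finset.sum_product]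
  have h2 : Ex w (fun ω => f ω * g ω) * Ex w (fun _ => 1)
      = ∑ x ∈ (univ : Finset (ι → α)) ×ˢ (univ : Finset (ι → α)),
      ((∏ i, w i (x.1 i)) * (f x.1 * g x.1)) * ((∏ i, w i (x.2 i)) * 1) := by
    unfold Ex; rw [Finset.sum_mul_sum, Finset.sum_product]
  rw [Ex_const hw, mul_one] at h2
  rw [h1, h2]
  refine Finset.sum_bij' (fun x _ => (fun i => if i ∈ A then x.1 i else x.2 i,
      fun i => if i ∈ A then x.2 i else x.1 i))
    (fun x _ => (fun i => if i ∈ A then x.1 i else x.2 i,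
      fun i => if i ∈ A then x.2 i else x.1 i)) ?_ ?_ ?_ ?_ ?_
  · intros; simp
  · intros; simp
  · rintro ⟨ω, a⟩ _; ext i <;> by_cases h : i ∈ A <;> simp [h]
  · rintro ⟨ω, a⟩ _; ext i <;> by_cases h : i ∈ A <;> simp [h]
  · rintro ⟨ω, ω'⟩ _
    dsimp only
    rw [hf (fun i => if i ∈ A then ω i else ω' i) ω (fun i hi => by simp [hi]),
      hg (fun i => if i ∈ A then ω' i else ω i) ω (fun i hi => by simp [hi])]
    have : (∏ i, w i (if i ∈ A then ω i else ω' i)) * (∏ i, w i (if i ∈ A then ω' i else ω i))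
        = (∏ i, w i (ω i)) * ∏ i, w i (ω' i) := by
      rw [← Finset.prod_mul_distrib, ← Finset.prod_mul_distrib]
      refine Finset.prod_congr rfl fun i _ => ?_
      split_ifs <;> ring
    linear_combination (- f ω * g ω) * this

/-- Lovasz local lemma -/
lemma LLL (hw : IsW w) {J : Type} [Fintype J] (A : J → (ι → α) → Prop) (N : J → Finset ι)
    (hA : ∀ j ω ω', (∀ i ∈ N j, ω i = ω' i) → (A j ω ↔ A j ω')) (x : ℝ) (D : ℝ)
    (hx : ∀ j, Pr w (A j) ≤ x) (hD1 : 1 ≤ D)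
    (hD : ∀ j, A j ≠ (fun _ => False) →
      ((univ.filter fun i => A i ≠ (fun _ => False) ∧ ¬ Disjoint (N i) (N j)).card : ℝ) ≤ D)
    (hxD : 4 * x * D ≤ 1) : ∃ ω, ∀ j, ¬ A j ω := by
  let B : Finset J → (ι → α) → Prop := fun S ω => ∀ i ∈ S, ¬ A i ω
  have hx0' : ∀ j : J, 0 ≤ x := fun j => (Pr_nonneg hw (A j)).trans (hx j)
  -- main claim
  have main : ∀ n : ℕ, ∀ S : Finset J, S.card = n →
      (0 < Pr w (B S)) ∧ ∀ j, Pr w (fun ω => A j ω ∧ B S ω) ≤ 2 * x * Pr w (B S) := by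
    intro n
    induction n using Nat.strong_induction_on with
    | _ n ih =>
    intro S hS
    have pos : 0 < Pr w (B S) := by
      rcases S.eq_empty_or_nonempty with rfl | ⟨j, hj⟩
      · have : Pr w (B ∅) = 1 := by
          unfold Pr
          rw [← Ex_const hw 1]; congr 1; ext ω; exact ind_true (by simp [B])
        rw [this]; norm_num
      · have hc : (S.erase j).card < n := by rw [← hS]; exact Finset.card_erase_lt_of_mem hj
        obtain ⟨h1, h2⟩ := ih _ hc (S.erase j) rfl
        have h3 := h2 j
        have h4 : Pr w (B (S.erase j)) ≤ Pr w (B S) + Pr w (fun ω => A j ω ∧ B (S.erase j) ω) := by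
          refine le_trans (Pr_mono hw ?_) (Pr_or hw _ _)
          intro ω hω
          by_cases hj' : A j ω
          · exact Or.inr ⟨hj', hω⟩
          · left; intro i hi
            by_cases hij : i = j
            · rwa [hij]
            · exact hω i (Finset.mem_erase.2 ⟨hij, hi⟩)
        have : 2 * x ≤ 1 / 2 := by nlinarith [hx0' j]
        nlinarith
    refine ⟨pos, fun j => ?_⟩
    by_cases hjF : A j = (fun _ => False)
    · have : Pr w (fun ω => A j ω ∧ B S ω) = 0 := by
        rw [hjF]; unfold Pr; simp [ind, Ex_const hw]
      rw [this]; exact mul_nonneg (mul_nonneg (by norm_num) (hx0' j)) pos.le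
    let S1 := S.filter fun i => A i ≠ (fun _ => False) ∧ ¬ Disjoint (N i) (N j)
    let S2 := S.filter fun i => A i ≠ (fun _ => False) ∧ Disjoint (N i) (N j)
    have hind : Pr w (fun ω => A j ω ∧ B S2 ω) = Pr w (A j) * Pr w (B S2) := by
      unfold Pr
      rw [← Ex_indep hw (N j)]
      · congr 1; ext ω; exact ind_and _ _
      · intro ω ω' h; exact ind_congr (hA j ω ω' h)
      · intro ω ω' h
        refine ind_congr ?_
        refine forall_congr' fun i => forall_congr' fun hi => not_congr ?_
        refine hA i ω ω' fun l hl => h l ?_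
        have := (Finset.mem_filter.1 hi).2.2
        exact fun hl' => (Finset.disjoint_left.1 this) hl hl'
    have h1 : Pr w (fun ω => A j ω ∧ B S ω) ≤ x * Pr w (B S2) := by
      refine le_trans (Pr_mono hw (B := fun ω => A j ω ∧ B S2 ω) ?_) ?_
      · rintro ω ⟨ha, hb⟩
        exact ⟨ha, fun i hi => hb i (Finset.mem_filter.1 hi).1⟩
      · rw [hind]; exact mul_le_mul_of_nonneg_right (hx j) (Pr_nonneg hw _)
    have h2 : Pr w (B S2) ≤ 2 * Pr w (B S) := by
      rcases S1.eq_empty_or_nonempty with he | ⟨j1, hj1⟩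
      · have : Pr w (B S2) ≤ Pr w (B S) := by
          refine Pr_mono hw fun ω hω i hi => ?_
          by_cases hF : A i = (fun _ => False)
          · rw [hF]; exact id
          · refine hω i (Finset.mem_filter.2 ⟨hi, hF, ?_⟩)
            by_contra hd
            have : i ∈ S1 := Finset.mem_filter.2 ⟨hi, hF, hd⟩
            rw [he] at this; simp at this
        linarith [Pr_nonneg hw (B S)]
      · have hc : S2.card < n := by
          rw [← hS]
          refine Finset.card_lt_card ⟨Finset.filter_subset _ _, fun hsub => ?_⟩
          have h3 := Finset.mem_filter.1 hj1
          exact h3.2.2 (Finset.mem_filter.1 (hsub h3.1)).2.2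
        obtain ⟨q1, q2⟩ := ih _ hc S2 rfl
        have h4 : Pr w (B S2) ≤ Pr w (B S) + ∑ i ∈ S1, Pr w (fun ω => A i ω ∧ B S2 ω) := by
          refine le_trans (Pr_mono hw ?_) ((Pr_or hw _ _).trans
            (add_le_add_right (Pr_exists hw S1 (fun i ω => A i ω ∧ B S2 ω)) _))
          intro ω hω
          by_cases hb : B S ω
          · exact Or.inl hb
          · right
            simp only [B, not_forall, not_not] at hb
            obtain ⟨i, hi, hai⟩ := hb
            refine ⟨i, Finset.mem_filter.2 ⟨hi, ?_, ?_⟩, hai, hω⟩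
            · intro hF; rw [hF] at hai; exact hai
            · intro hd
              refine hω i (Finset.mem_filter.2 ⟨hi, ?_, hd⟩) hai
              intro hF; rw [hF] at hai; exact hai
        have h5 : ∑ i ∈ S1, Pr w (fun ω => A i ω ∧ B S2 ω) ≤ S1.card * (2 * x * Pr w (B S2)) := by
          rw [← nsmul_eq_mul]
          exact Finset.sum_le_card_nsmul _ _ _ fun i _ => q2 i
        have h6 : (S1.card : ℝ) ≤ D := by
          refine le_trans ?_ (hD j hjF)
          exact_mod_cast Finset.card_le_card (fun i hi => by
            have := Finset.mem_filter.1 hi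
            exact Finset.mem_filter.2 ⟨mem_univ _, this.2⟩)
        have h7 : (S1.card : ℝ) * (2 * x * Pr w (B S2)) ≤ D * (2 * x * Pr w (B S2)) :=
          mul_le_mul_of_nonneg_right h6 (mul_nonneg (mul_nonneg (by norm_num) (hx0' j)) q1.le)
        nlinarith
    nlinarith [hx0' j]
  have h := (main _ univ rfl).1
  by_contra hcon
  push Not at hcon
  have : Pr w (B univ) = 0 := by
    unfold Pr
    have : (fun ω => ind (B univ ω)) = fun _ => 0 := by
      ext ω
      obtain ⟨j, hj⟩ := hcon ω
      refine ind_false ?_; intro hb; exact hb j (mem_univ j) hj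
    rw [this, Ex_const hw]
  linarith

end basics


/-- bit weight -/
def bw (x : ℝ) (b : Bool) : ℝ := cond b x (1 - x)

lemma bw_isW {ι : Type} [Fintype ι] {x : ι → ℝ} (h0 : ∀ i, 0 ≤ x i) (h1 : ∀ i, x i ≤ 1) :
    IsW (fun i => bw (x i)) := by
  refine ⟨fun i a => ?_, fun i => ?_⟩
  · cases a
    · simpa [bw] using h1 i
    · simpa [bw] using h0 i
  · simp [bw]

lemma bits_prob {ι : Type} [Fintype ι] (x : ι → ℝ) (A B : Finset ι) (hAB : Disjoint A B) :
    Ex (fun i => bw (x i)) (fun ω => ind ((∀ i ∈ A, ω i = false) ∧ ∀ i ∈ B, ω i = true))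
      = (∏ i ∈ A, (1 - x i)) * ∏ i ∈ B, x i := by
  have h1 : (fun ω : ι → Bool => ind ((∀ i ∈ A, ω i = false) ∧ ∀ i ∈ B, ω i = true))
      = fun ω => ∏ i, (ind (i ∈ A → ω i = false) * ind (i ∈ B → ω i = true)) := by
    ext ω
    by_cases h : (∀ i ∈ A, ω i = false) ∧ ∀ i ∈ B, ω i = true
    · rw [ind_true h]
      symm
      refine Finset.prod_eq_one fun i _ => ?_
      rw [ind_true (h.1 i), ind_true (h.2 i), one_mul]
    · rw [ind_false h]
      symm
      rw [not_and_or] at h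
      rcases h with h | h
      · push Not at h
        obtain ⟨i, hi, h⟩ := h
        refine Finset.prod_eq_zero (mem_univ i) ?_
        rw [ind_false (P := i ∈ A → ω i = false) (fun h' => h (h' hi)), zero_mul]
      · push Not at h
        obtain ⟨i, hi, h⟩ := h
        refine Finset.prod_eq_zero (mem_univ i) ?_
        rw [ind_false (P := i ∈ B → ω i = true) (fun h' => h (h' hi)), mul_zero]
  rw [h1, Ex_prod (fun i b => ind (i ∈ A → b = false) * ind (i ∈ B → b = true))]
  rw [← Finset.prod_ite_mem_eq A, ← Finset.prod_ite_mem_eq B, ← Finset.prod_mul_distrib]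
  refine Finset.prod_congr rfl fun i _ => ?_
  by_cases hA : i ∈ A
  · have hB : i ∉ B := Finset.disjoint_left.1 hAB hA
    simp [hA, hB, bw, ind]
  · by_cases hB : i ∈ B <;> simp [hA, hB, bw, ind]

section rows
variable {ι K : Type} [Fintype ι] [Fintype K]

/-- row weights -/
def rowW (pr : ι → K → ℝ) (i : ι) (row : K → Bool) : ℝ := ∏ c, bw (pr i c) (row c)

lemma rowW_isW {pr : ι → K → ℝ} (h0 : ∀ i c, 0 ≤ pr i c) (h1 : ∀ i c, pr i c ≤ 1) :
    IsW (rowW pr) := by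
  refine ⟨fun i a => ?_, fun i => ?_⟩
  · exact (bw_isW (h0 i) (h1 i)).prod_nonneg a
  · have := Ex_const (bw_isW (h0 i) (h1 i)) 1
    unfold Ex at this
    simpa [rowW] using this

lemma rowW_sum (pr : ι → K → ℝ) (i : ι) (f : (K → Bool) → ℝ) :
    ∑ a, rowW pr i a * f a = Ex (fun c => bw (pr i c)) f := rfl

lemma swap_Ex (pr : ι → K → ℝ) (f : (ι → K → Bool) → ℝ) :
    Ex (rowW pr) f = Ex (rowW fun c i => pr i c) (fun ω => f (fun i c => ω c i)) := by
  unfold Ex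
  refine Fintype.sum_equiv (Equiv.piComm fun _ _ => Bool) _ _ fun ω => ?_
  have : (∏ i, rowW pr i (ω i)) = ∏ c, rowW (fun c i => pr i c) c (fun i => ω i c) := by
    unfold rowW; exact Finset.prod_comm
  rw [this]; rfl

lemma swap_Pr (pr : ι → K → ℝ) (A : (ι → K → Bool) → Prop) :
    Pr (rowW pr) A = Pr (rowW fun c i => pr i c) (fun ω => A (fun i c => ω c i)) := swap_Ex pr _

/-- union bound for bits -/
lemma bits_union {x : K → ℝ} (h0 : ∀ i, 0 ≤ x i) (h1 : ∀ i, x i ≤ 1) (B : Finset K) :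
    Ex (fun c => bw (x c)) (fun ω => ind (∃ c ∈ B, ω c = true)) ≤ ∑ c ∈ B, x c := by
  refine (Pr_exists (bw_isW h0 h1) B (fun c ω => ω c = true)).trans (le_of_eq ?_)
  refine Finset.sum_congr rfl fun c _ => ?_
  have := bits_prob x ∅ {c} (by simp)
  simpa [Pr] using this

lemma bits_exists {x : K → ℝ} (h0 : ∀ i, 0 ≤ x i) (h1 : ∀ i, x i ≤ 1) (B : Finset K) :
    Ex (fun c => bw (x c)) (fun ω => ind (∃ c ∈ B, ω c = true)) = 1 - ∏ c ∈ B, (1 - x c) := by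
  have h := bits_prob x B ∅ (by simp)
  have h2 : (fun ω : K → Bool => ind (∃ c ∈ B, ω c = true))
      = fun ω => 1 + (-1) * ind ((∀ i ∈ B, ω i = false) ∧ ∀ i ∈ (∅ : Finset K), ω i = true) := by
    ext ω
    by_cases h : ∃ c ∈ B, ω c = true
    · rw [ind_true h, ind_false]; · ring
      rintro ⟨h', -⟩
      obtain ⟨c, hc, h⟩ := h
      rw [h' c hc] at h; simp at h
    · rw [ind_false h, ind_true]; · ring
      push Not at h
      exact ⟨fun i hi => by simpa using h i hi, by simp⟩
  rw [h2, Ex_add, Ex_smul, h, Ex_const (bw_isW h0 h1)]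
  simp; ring

end rows

/-- two copies of a type -/
inductive Two (V : Type) : Type
  | inl : V → Two V
  | inr : V → Two V

/-- equivalence with sum -/
def Two.eqv (V : Type) : V ⊕ V ≃ Two V where
  toFun := Sum.elim Two.inl Two.inr
  invFun := fun x => match x with
    | Two.inl v => Sum.inl v
    | Two.inr v => Sum.inr v
  left_inv := by rintro (x | x) <;> rfl
  right_inv := by rintro (x | x) <;> rfl

instance Two.fin (V : Type) [Fintype V] : Fintype (Two V) := Fintype.ofEquiv _ (Two.eqv V)

/-- embedding -/
def Two.inlE {V : Type} : V ↪ Two V := ⟨Two.inl, fun a b h => by cases h; rfl⟩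
/-- embedding -/
def Two.inrE {V : Type} : V ↪ Two V := ⟨Two.inr, fun a b h => by cases h; rfl⟩
@[simp] lemma Two.inlE_apply {V : Type} (v : V) : Two.inlE v = Two.inl v := rfl
@[simp] lemma Two.inrE_apply {V : Type} (v : V) : Two.inrE v = Two.inr v := rfl

/-- neighbours of `v` having `c` in their list -/
def nbc {V K : Type} [Fintype V] (G : SimpleGraph V) (L : V → Finset K) (v : V) (c : K) :
    Finset V := univ.filter fun u => G.Adj v u ∧ c ∈ L u

/-- context of one round -/
structure Ctx (V K : Type) [Fintype V] [Fintype K] where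
  G : SimpleGraph V
  U : Finset V
  L : V → Finset K
  P : V → Finset K
  p : ℕ
  T : ℝ
  β : ℝ
  k : ℝ
  Δ : ℕ
  hβ0 : 0 < β
  hβ : β ≤ 1 / 1000
  hp : 1 ≤ p
  hT : (p : ℝ) / 16 ≤ T
  hLU : ∀ u, u ∉ U → L u = ∅
  hPL : ∀ u, P u ⊆ L u
  hPc : ∀ u ∈ U, (P u).card = p
  hD : ∀ v ∈ U, ∀ c ∈ L v, ((nbc G L v c).card : ℝ) ≤ T
  hS : ∀ v ∈ U, (p : ℝ) * T ≤ ∑ c ∈ L v, (T - ((nbc G L v c).card : ℝ))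
  hk : 4 * k ≤ β * p * T
  hsp : LocallySparse G k
  hΔ : ∀ v, G.degree v ≤ Δ

namespace Ctx
variable {V K : Type} [Fintype V] [Fintype K] (S : Ctx V K)

def Nc (v : V) (c : K) : Finset V := nbc S.G S.L v c
def NP (v : V) (c : K) : Finset V := nbc S.G S.P v c
def lam : ℝ := S.β / S.T
def eta : ℝ := S.β * S.p / S.T
def tau : ℝ := S.β * S.eta
def kap : ℝ := 1 - S.β
/-- length of list -/
def ell (v : V) : ℝ := ((S.L v).card : ℝ)

/-- bit probabilities -/
def pr : Two V → K → ℝ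
  | Two.inl _, _ => S.lam
  | Two.inr v, c => min 1 (S.kap / (1 - S.lam) ^ (S.NP v c).card)

lemma p_pos : (0 : ℝ) < S.p := by exact_mod_cast S.hp
lemma T_pos : 0 < S.T := lt_of_lt_of_le (by have := S.p_pos; positivity) S.hT
lemma lam_pos : 0 < S.lam := div_pos S.hβ0 S.T_pos
lemma lamT : S.lam * S.T = S.β := div_mul_cancel₀ _ S.T_pos.ne'
lemma lamp : S.lam * S.p = S.eta := by unfold lam eta; ring
lemma etaT : S.eta * S.T = S.β * S.p := div_mul_cancel₀ _ S.T_pos.ne'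
lemma eta_pos : 0 < S.eta := by rw [← S.lamp]; exact mul_pos S.lam_pos S.p_pos
lemma eta_le : S.eta ≤ 16 * S.β := by
  unfold eta
  rw [div_le_iff₀ S.T_pos]
  have := S.hT
  nlinarith [S.hβ0]
lemma lam_le : S.lam ≤ S.eta := by
  rw [← S.lamp]
  have : (1 : ℝ) ≤ S.p := by exact_mod_cast S.hp
  nlinarith [S.lam_pos]
lemma lam_lt : S.lam ≤ 1 / 2 := by
  have := S.lam_le; have := S.eta_le; have := S.hβ; linarith
lemma tau_pos : 0 < S.tau := mul_pos S.hβ0 S.eta_pos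
lemma tau_le : S.tau ≤ 16 * S.β ^ 2 := by
  unfold tau; nlinarith [S.eta_le, S.hβ0]
lemma tauT : S.tau * S.T = S.β ^ 2 * S.p := by
  unfold tau; rw [mul_assoc, S.etaT]; ring
lemma kap_pos : 0 < S.kap := by have := S.hβ; unfold kap; linarith
lemma kap_le : S.kap ≤ 1 := by have := S.hβ0; unfold kap; linarith

lemma pr_nonneg (i : Two V) (c : K) : 0 ≤ S.pr i c := by
  cases i
  · exact S.lam_pos.le
  · refine le_min zero_le_one (div_nonneg S.kap_pos.le (pow_nonneg ?_ _))
    linarith [S.lam_lt]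
lemma pr_le (i : Two V) (c : K) : S.pr i c ≤ 1 := by
  cases i
  · show S.lam ≤ 1; linarith [S.lam_lt]
  · exact min_le_left _ _

/-- the measure -/
def w : Two V → (K → Bool) → ℝ := rowW S.pr
/-- the column measure -/
def wc : K → (Two V → Bool) → ℝ := rowW (fun c i => S.pr i c)
lemma w_isW : IsW S.w := rowW_isW S.pr_nonneg S.pr_le
lemma wc_isW : IsW S.wc := rowW_isW (fun c i => S.pr_nonneg i c) (fun c i => S.pr_le i c)
lemma w_swap (A : (Two V → K → Bool) → Prop) :
    Pr S.w A = Pr S.wc (fun ω => A (fun i c => ω c i)) := swap_Pr _ _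

lemma mem_Nc {v u : V} {c : K} : u ∈ S.Nc v c ↔ S.G.Adj v u ∧ c ∈ S.L u := by
  simp [Nc, nbc]
lemma mem_NP {v u : V} {c : K} : u ∈ S.NP v c ↔ S.G.Adj v u ∧ c ∈ S.P u := by
  simp [NP, nbc]
lemma NP_sub (v : V) (c : K) : S.NP v c ⊆ S.Nc v c := by
  intro u hu; rw [mem_NP] at hu; rw [mem_Nc]; exact ⟨hu.1, S.hPL u hu.2⟩
lemma mem_U {u : V} {c : K} (h : c ∈ S.L u) : u ∈ S.U := by
  by_contra hu; rw [S.hLU u hu] at h; simp at h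
lemma Nc_le {u : V} {c : K} (h : c ∈ S.L u) : ((S.Nc u c).card : ℝ) ≤ S.T :=
  S.hD u (S.mem_U h) c h
lemma NP_le {u : V} {c : K} (h : c ∈ S.L u) : ((S.NP u c).card : ℝ) ≤ S.T :=
  le_trans (by exact_mod_cast Finset.card_le_card (S.NP_sub u c)) (S.Nc_le h)

/-- column survival -/
def SurvC (c : K) (u : V) (col : Two V → Bool) : Prop :=
  col (Two.inr u) = true ∧ ∀ w ∈ S.NP u c, col (Two.inl w) = false

lemma pow_ge {m : ℕ} (h : (m : ℝ) ≤ S.T) : 1 - S.lam * m ≤ (1 - S.lam) ^ m := by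
  have := one_add_mul_le_pow (a := -S.lam) (by linarith [S.lam_lt]) m
  rw [← sub_eq_add_neg] at this
  linarith

lemma pow_pos' (m : ℕ) : 0 < (1 - S.lam) ^ m := pow_pos (by linarith [S.lam_lt]) m

lemma pr_inr {u : V} {c : K} (h : c ∈ S.L u) :
    S.pr (Two.inr u) c = S.kap / (1 - S.lam) ^ (S.NP u c).card := by
  refine min_eq_right ?_
  rw [div_le_one (S.pow_pos' _)]
  refine le_trans ?_ (S.pow_ge (S.NP_le h))
  have := S.NP_le h
  have h2 := S.lamT
  unfold kap
  nlinarith [S.lam_pos]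

lemma prod_inl (c : K) (A : Finset V) :
    ∏ i ∈ A.map Two.inlE, (1 - S.pr i c) = (1 - S.lam) ^ A.card := by
  rw [Finset.prod_map]
  simp [pr]

lemma disj_lr (A B : Finset V) :
    Disjoint (A.map Two.inlE) (B.map Two.inrE) := by
  rw [Finset.disjoint_left]; intro i h1 h2
  simp only [mem_map] at h1 h2
  obtain ⟨a, -, rfl⟩ := h1
  obtain ⟨b, -, h⟩ := h2
  simp at h

lemma surv_prob {u : V} {c : K} (h : c ∈ S.L u) :
    Ex (fun i => bw (S.pr i c)) (fun col => ind (S.SurvC c u col)) = S.kap := by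
  have h1 := bits_prob (fun i => S.pr i c) ((S.NP u c).map Two.inlE)
    (({u} : Finset V).map Two.inrE) (disj_lr _ _)
  rw [prod_inl, Finset.prod_map] at h1
  simp only [prod_singleton, Two.inrE_apply] at h1
  rw [S.pr_inr h, mul_div_cancel₀ _ (S.pow_pos' _).ne'] at h1
  rw [← h1]
  congr 1; ext col
  refine ind_congr ?_
  simp [SurvC, and_comm]

lemma both_prob {u v : V} {c : K} (huv : u ≠ v) (hu : c ∈ S.L u) (hv : c ∈ S.L v) :
    Ex (fun i => bw (S.pr i c)) (fun col => ind (S.SurvC c u col ∧ S.SurvC c v col))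
      ≤ S.kap ^ 2 + 2 * S.lam * ((S.NP u c ∩ S.NP v c).card : ℝ) := by
  have h1 := bits_prob (fun i => S.pr i c) ((S.NP u c ∪ S.NP v c).map Two.inlE)
    (({u, v} : Finset V).map Two.inrE) (disj_lr _ _)
  rw [prod_inl, Finset.prod_map, Finset.prod_pair huv] at h1
  simp only [Two.inrE_apply] at h1
  rw [S.pr_inr hu, S.pr_inr hv] at h1
  have h2 : Ex (fun i => bw (S.pr i c)) (fun col => ind (S.SurvC c u col ∧ S.SurvC c v col))
      = (1 - S.lam) ^ (S.NP u c ∪ S.NP v c).card * (S.kap / (1 - S.lam) ^ (S.NP u c).card *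
        (S.kap / (1 - S.lam) ^ (S.NP v c).card)) := by
    rw [← h1]
    congr 1; ext col
    refine ind_congr ?_
    simp only [SurvC, mem_map, mem_union, Two.inlE_apply, mem_insert, mem_singleton,
      Two.inrE_apply, forall_exists_index, and_imp]
    constructor
    · rintro ⟨⟨a1, a2⟩, b1, b2⟩
      refine ⟨?_, ?_⟩
      · rintro i x (hx | hx) rfl
        · exact a2 x hx
        · exact b2 x hx
      · rintro i x (rfl | rfl) rfl
        · exact a1
        · exact b1
    · rintro ⟨a, b⟩
      exact ⟨⟨b _ u (Or.inl rfl) rfl, fun w hw => a _ w (Or.inl hw) rfl⟩,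
        b _ v (Or.inr rfl) rfl, fun w hw => a _ w (Or.inr hw) rfl⟩
  rw [h2]
  set m := (S.NP u c ∩ S.NP v c).card with hm
  have hc : (S.NP u c ∪ S.NP v c).card + m = (S.NP u c).card + (S.NP v c).card :=
    Finset.card_union_add_card_inter _ _
  have hmT : (m : ℝ) ≤ S.T :=
    le_trans (by exact_mod_cast Finset.card_le_card Finset.inter_subset_left) (S.NP_le hu)
  have h3 := S.pow_ge hmT
  have h4 : S.lam * m ≤ 1 / 1000 := by
    have := S.lamT; have := S.hβ; nlinarith [S.lam_pos]
  have h0 : 0 ≤ S.lam * m := mul_nonneg S.lam_pos.le (Nat.cast_nonneg _)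
  have p1 := S.pow_pos' (S.NP u c).card
  have p2 := S.pow_pos' (S.NP v c).card
  have p3 := S.pow_pos' m
  have p4 := S.pow_pos' (S.NP u c ∪ S.NP v c).card
  have e : (1 - S.lam) ^ (S.NP u c ∪ S.NP v c).card * (S.kap / (1 - S.lam) ^ (S.NP u c).card *
        (S.kap / (1 - S.lam) ^ (S.NP v c).card)) = S.kap ^ 2 / (1 - S.lam) ^ m := by
    have : (1 - S.lam) ^ (S.NP u c ∪ S.NP v c).card * (1 - S.lam) ^ m
      = (1 - S.lam) ^ (S.NP u c).card * (1 - S.lam) ^ (S.NP v c).card := by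
      rw [← pow_add, hc, pow_add]
    field_simp
    linear_combination S.kap ^ 2 * this
  rw [e, div_le_iff₀ p3]
  have k1 : S.kap ^ 2 ≤ 1 := by nlinarith [S.kap_le, S.kap_pos]
  have k0 : 0 ≤ S.kap ^ 2 := sq_nonneg _
  calc S.kap ^ 2 ≤ (S.kap ^ 2 + 2 * (S.lam * m)) * (1 - S.lam * m) := by nlinarith
    _ ≤ (S.kap ^ 2 + 2 * (S.lam * m)) * (1 - S.lam) ^ m := by gcongr
    _ = _ := by ring

/-- total common neighbours -/
lemma common_le (v : V) (c : K) :
    ∑ u ∈ S.Nc v c, ((S.NP u c ∩ S.NP v c).card : ℝ) ≤ 2 * S.k := by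
  refine le_trans ?_ (S.hsp v)
  have : ∑ u ∈ S.Nc v c, (S.NP u c ∩ S.NP v c).card ≤ pairsWithin S.G (S.G.neighborFinset v) := by
    rw [← Finset.card_sigma]
    unfold pairsWithin
    refine Finset.card_le_card_of_injOn (fun x => (x.1, x.2)) ?_ ?_
    · rintro ⟨u, w⟩ h
      simp only [coe_sigma, Set.mem_sigma_iff, mem_coe, mem_inter, mem_NP, mem_Nc] at h
      simp [h.1.1, h.2.2.1, h.2.1.1]
    · rintro ⟨u, w⟩ _ ⟨u', w'⟩ _ h
      simp only [Prod.mk.injEq] at h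
      obtain ⟨rfl, rfl⟩ := h; rfl
  exact_mod_cast this

lemma sumD {v : V} (hv : v ∈ S.U) :
    ∑ c ∈ S.L v, ((S.Nc v c).card : ℝ) ≤ (S.ell v - S.p) * S.T := by
  have := S.hS v hv
  rw [Finset.sum_sub_distrib, Finset.sum_const, nsmul_eq_mul] at this
  unfold ell Nc
  linarith

lemma p_le_ell {v : V} (hv : v ∈ S.U) : (S.p : ℝ) ≤ S.ell v := by
  have h := S.sumD hv
  have h2 : (0 : ℝ) ≤ ∑ c ∈ S.L v, ((S.Nc v c).card : ℝ) :=
    Finset.sum_nonneg fun _ _ => Nat.cast_nonneg _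
  nlinarith [S.T_pos]

lemma sumD' {v : V} (hv : v ∈ S.U) :
    ∑ c ∈ S.L v, ((S.Nc v c).card : ℝ) ≤ S.ell v * S.T := by
  have := S.sumD hv
  nlinarith [S.T_pos, S.p_pos]

end Ctx

/-- lift function to two copies -/
def Two.onL {V β : Type} (f : V → β) : Two V → β
  | Two.inl v => f v
  | Two.inr v => f v

namespace Ctx
variable {V K : Type} [Fintype V] [Fintype K] (S : Ctx V K)

/-- survival -/
def Surv (ω : Two V → K → Bool) (u : V) (c : K) : Prop := S.SurvC c u (fun i => ω i c)
/-- some color is picked -/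
def Act (ω : Two V → K → Bool) (u : V) : Prop := ∃ c ∈ S.P u, ω (Two.inl u) c = true
/-- neighbours -/
def Nb (v : V) : Finset V := univ.filter fun u => S.G.Adj v u
/-- common colors -/
def a (v u : V) : ℝ := ((S.L u ∩ S.L v).card : ℝ)

lemma dbl (v : V) (f : V → K → ℝ) :
    ∑ u ∈ S.Nb v, ∑ c ∈ S.L u ∩ S.L v, f u c = ∑ c ∈ S.L v, ∑ u ∈ S.Nc v c, f u c := by
  refine Finset.sum_comm' ?_
  intro u c
  simp only [Nb, mem_filter, mem_univ, true_and, mem_inter, mem_Nc]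
  tauto

lemma sum_a (v : V) : ∑ u ∈ S.Nb v, S.a v u = ∑ c ∈ S.L v, ((S.Nc v c).card : ℝ) := by
  have := S.dbl v (fun _ _ => 1)
  simpa [a] using this

lemma a_nonneg (v u : V) : 0 ≤ S.a v u := Nat.cast_nonneg _
lemma a_le (v u : V) : S.a v u ≤ S.ell v := by
  unfold a ell; exact_mod_cast Finset.card_le_card Finset.inter_subset_right

lemma ell_pos {v : V} (hv : v ∈ S.U) : 0 < S.ell v := lt_of_lt_of_le S.p_pos (S.p_le_ell hv)

lemma e1 {v : V} (hv : v ∈ S.U) :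
    Pr S.w (fun ω => ∑ c ∈ S.L v, ind (S.Surv ω v c) ≤ (S.kap - S.tau) * S.ell v)
      ≤ Real.exp (-(S.tau ^ 2 * S.p / 8)) := by
  rw [w_swap]
  have h := tail_lower_indep S.wc_isW (S.L v) (fun c col => ind (S.SurvC c v col)) 1 (S.tau / 2)
    (S.tau / 2 * S.ell v) (by have := S.tau_pos; linarith)
    (by have := S.tau_le; have := S.hβ; have := S.hβ0; nlinarith)
    (fun c _ col => ind_nonneg _) (fun c _ col => ind_le_one _) (fun _ => S.kap)
    (fun c hc => (S.surv_prob hc).ge)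
  refine (Pr_mono S.wc_isW ?_).trans (h.trans ?_)
  · intro ω hω
    refine le_trans hω ?_
    rw [Finset.sum_const, nsmul_eq_mul]
    change _ ≤ (1 - S.tau / 2 * 1) * (S.ell v * S.kap) - _
    have := S.ell_pos hv
    have h1 := S.kap_le
    have := S.tau_pos
    nlinarith [mul_nonneg (mul_pos S.tau_pos (S.ell_pos hv)).le (sub_nonneg.2 h1)]
  · refine Real.exp_le_exp.2 (neg_le_neg ?_)
    have := S.p_le_ell hv
    have h2 : 0 < S.tau ^ 2 := pow_pos S.tau_pos 2
    nlinarith [S.p_pos]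

lemma e2 {v : V} (hv : v ∈ S.U) :
    Pr S.w (fun ω => S.kap ^ 2 * ∑ c ∈ S.L v, ((S.Nc v c).card : ℝ) + 3 * S.tau * S.ell v * S.T
        ≤ ∑ c ∈ S.L v, ∑ u ∈ S.Nc v c, ind (S.Surv ω u c ∧ S.Surv ω v c))
      ≤ Real.exp (-(S.tau ^ 2 * S.p / 8)) := by
  rw [w_swap]
  have hT := S.T_pos
  have ht := S.tau_pos
  have h := tail_upper_indep S.wc_isW (S.L v)
    (fun c col => ∑ u ∈ S.Nc v c, ind (S.SurvC c u col ∧ S.SurvC c v col)) S.T (S.tau / (4 * S.T))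
    (S.tau / 2 * S.ell v * S.T) (by positivity)
    (by
      have := S.tau_le; have := S.hβ; have := S.hβ0
      field_simp; nlinarith)
    (fun c _ col => Finset.sum_nonneg fun u _ => ind_nonneg _)
    (fun c hc col => by
      refine le_trans ?_ (S.Nc_le hc)
      refine (Finset.sum_le_sum fun u _ => ind_le_one _).trans ?_
      simp)
    (fun c => S.kap ^ 2 * ((S.Nc v c).card : ℝ) + 4 * S.lam * S.k)
    (fun c hc => by
      have e := Ex_sum (w := fun i => bw (S.pr i c)) (S.Nc v c)
        (fun u col => ind (S.SurvC c u col ∧ S.SurvC c v col))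
      refine le_trans (le_of_eq e) ?_
      refine (Finset.sum_le_sum fun u hu => S.both_prob (u := u) (v := v) (c := c) ?_ ?_ hc).trans ?_
      · have := (S.mem_Nc.1 hu).1; exact this.ne'
      · exact (S.mem_Nc.1 hu).2
      · rw [Finset.sum_add_distrib, Finset.sum_const, nsmul_eq_mul, ← Finset.mul_sum]
        have := S.common_le v c
        have := S.lam_pos
        nlinarith)
  refine (Pr_mono S.wc_isW ?_).trans (h.trans ?_)
  · intro ω hω
    refine le_trans ?_ hω
    rw [Finset.sum_add_distrib, Finset.sum_const, nsmul_eq_mul, ← Finset.mul_sum]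
    change (1 + S.tau / (4 * S.T) * S.T) * (S.kap ^ 2 * _ + S.ell v * (4 * S.lam * S.k)) + _ ≤ _
    have e1 : S.tau / (4 * S.T) * S.T = S.tau / 4 := by field_simp
    rw [e1]
    have h1 := S.sumD' hv
    set D := ∑ c ∈ S.L v, ((S.Nc v c).card : ℝ)
    have hD0 : 0 ≤ D := Finset.sum_nonneg fun _ _ => Nat.cast_nonneg _
    have hl := S.ell_pos hv
    have k1 : S.kap ^ 2 ≤ 1 := by nlinarith [S.kap_le, S.kap_pos]
    have k2 : S.kap ^ 2 * D ≤ S.ell v * S.T := by nlinarith [sq_nonneg S.kap]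
    have k3 : 4 * S.lam * S.k ≤ S.tau * S.T := by
      have := S.hk
      calc 4 * S.lam * S.k = S.lam * (4 * S.k) := by ring
        _ ≤ S.lam * (S.β * S.p * S.T) := by gcongr; exact S.lam_pos.le
        _ = S.tau * S.T := by rw [S.tauT]; linear_combination (S.β * S.p) * S.lamT
    have k4 : S.ell v * (4 * S.lam * S.k) ≤ S.ell v * (S.tau * S.T) := by gcongr
    have t1 : S.tau ≤ 1 := by have := S.tau_le; have := S.hβ; have := S.hβ0; nlinarith
    have k5 : S.tau / 4 * (S.kap ^ 2 * D) ≤ S.tau / 4 * (S.ell v * S.T) := by gcongr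
    have k6 : S.tau / 4 * (S.ell v * (4 * S.lam * S.k)) ≤ S.tau / 4 * (S.ell v * (S.tau * S.T)) := by
      gcongr
    have k7 : S.tau / 4 * (S.ell v * (S.tau * S.T)) ≤ 1 / 4 * (S.ell v * (S.tau * S.T)) := by
      gcongr
    have pos : 0 < S.ell v * (S.tau * S.T) := by positivity
    nlinarith
  · refine Real.exp_le_exp.2 (neg_le_neg ?_)
    have := S.p_le_ell hv
    have h2 : 0 < S.tau ^ 2 := pow_pos S.tau_pos 2
    have e : S.tau / (4 * S.T) * (S.tau / 2 * S.ell v * S.T) = S.tau ^ 2 * S.ell v / 8 := by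
      field_simp; ring
    rw [e]
    gcongr

lemma e8 {v : V} (hv : v ∈ S.U) :
    Pr S.w (fun ω => 3 * S.β * S.ell v * S.T
        ≤ ∑ c ∈ S.L v, ∑ u ∈ S.Nc v c, ind (¬ S.Surv ω u c))
      ≤ Real.exp (-(S.β * S.p)) := by
  rw [w_swap]
  have hT := S.T_pos
  have hb := S.hβ0
  have h := tail_upper_indep S.wc_isW (S.L v)
    (fun c col => ∑ u ∈ S.Nc v c, ind (¬ S.SurvC c u col)) S.T (1 / S.T)
    (S.β * S.ell v * S.T) (by positivity)
    (by field_simp; exact le_rfl)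
    (fun c _ col => Finset.sum_nonneg fun u _ => ind_nonneg _)
    (fun c hc col => by
      refine le_trans ?_ (S.Nc_le hc)
      refine (Finset.sum_le_sum fun u _ => ind_le_one _).trans ?_
      simp)
    (fun c => S.β * ((S.Nc v c).card : ℝ))
    (fun c hc => by
      have e := Ex_sum (w := fun i => bw (S.pr i c)) (S.Nc v c)
        (fun u col => ind (¬ S.SurvC c u col))
      refine le_trans (le_of_eq e) ?_
      rw [mul_comm, ← nsmul_eq_mul]
      refine Finset.sum_le_card_nsmul _ _ _ fun u hu => ?_
      have h1 := S.surv_prob (S.mem_Nc.1 hu).2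
      have h2 : (fun col => ind (¬ S.SurvC c u col)) = fun col => 1 + (-1) * ind (S.SurvC c u col) := by
        ext col; rw [ind_not]; ring
      rw [h2, Ex_add, Ex_smul, h1, Ex_const (bw_isW (fun i => S.pr_nonneg i c) (fun i => S.pr_le i c))]
      unfold kap; linarith)
  refine (Pr_mono S.wc_isW ?_).trans (h.trans ?_)
  · intro ω hω
    refine le_trans ?_ hω
    rw [← Finset.mul_sum]
    have e1 : 1 / S.T * S.T = 1 := by field_simp
    rw [e1]
    have h1 := S.sumD' hv
    nlinarith
  · refine Real.exp_le_exp.2 (neg_le_neg ?_)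
    have := S.p_le_ell hv
    have e : 1 / S.T * (S.β * S.ell v * S.T) = S.β * S.ell v := by
      field_simp
    rw [e]
    gcongr

/-- hit -/
def Hit (ω : Two V → K → Bool) (u : V) (c : K) : Prop := ∃ w ∈ S.NP u c, ω (Two.inl w) c = true

lemma e5 {u : V} (hu : u ∈ S.U) :
    Pr S.w (fun ω => 3 * S.β * S.p ≤ ∑ c ∈ S.P u, ind (S.Hit ω u c))
      ≤ Real.exp (-(S.β * S.p)) := by
  rw [w_swap]
  have hb := S.hβ0
  have h := tail_upper_indep S.wc_isW (S.P u)
    (fun c col => ind (∃ w ∈ S.NP u c, col (Two.inl w) = true)) 1 1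
    (S.β * S.p) (by positivity) (by norm_num)
    (fun c _ col => ind_nonneg _)
    (fun c hc col => ind_le_one _)
    (fun c => S.β)
    (fun c hc => by
      have e := bits_union (fun i => S.pr_nonneg i c) (fun i => S.pr_le i c)
        ((S.NP u c).map Two.inlE)
      have e2 : Ex (fun i => bw (S.pr i c)) (fun col => ind (∃ w ∈ S.NP u c, col (Two.inl w) = true))
        ≤ ∑ i ∈ (S.NP u c).map Two.inlE, S.pr i c := by
        refine le_trans (le_of_eq ?_) e
        congr 1; ext col; refine ind_congr ?_
        simp
      refine e2.trans ?_
      rw [Finset.sum_map]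
      simp only [Two.inlE_apply, pr, sum_const, nsmul_eq_mul]
      have := S.NP_le (S.hPL u hc)
      rw [← S.lamT, mul_comm]
      have := S.lam_pos
      gcongr)
  refine (Pr_mono S.wc_isW ?_).trans (h.trans ?_)
  · intro ω hω
    refine le_trans ?_ hω
    rw [Finset.sum_const, nsmul_eq_mul, S.hPc u hu]
    linarith
  · simp

lemma act_le {u : V} (Q : Finset K) :
    Ex (fun c => bw (S.pr (Two.inl u) c)) (fun row => ind (∃ c ∈ Q, row c = true))
      ≤ S.lam * Q.card := by
  refine (bits_union (fun c => S.pr_nonneg (Two.inl u) c) (fun c => S.pr_le (Two.inl u) c) Q).trans ?_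
  simp [pr, mul_comm]

lemma Pcard_le (u : V) : ((S.P u).card : ℝ) ≤ S.p := by
  by_cases hu : u ∈ S.U
  · rw [S.hPc u hu]
  · have : S.P u = ∅ := by
      have := S.hPL u; rw [S.hLU u hu] at this; exact Finset.subset_empty.1 this
    rw [this]; simp

lemma act_ge {u : V} (hu : u ∈ S.U) :
    S.eta - S.eta ^ 2 ≤
    Ex (fun c => bw (S.pr (Two.inl u) c)) (fun row => ind (∃ c ∈ S.P u, row c = true)) := by
  rw [bits_exists (fun c => S.pr_nonneg (Two.inl u) c) (fun c => S.pr_le (Two.inl u) c)]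
  simp only [pr, prod_const, S.hPc u hu]
  have h1 : (1 - S.lam) ^ S.p ≤ Real.exp (-S.eta) := by
    rw [← S.lamp, show -(S.lam * (S.p : ℝ)) = (S.p : ℝ) * (-S.lam) by ring, Real.exp_nat_mul]
    have := Real.add_one_le_exp (-S.lam)
    refine pow_le_pow_left₀ (by linarith [S.lam_lt]) (by linarith) _
  have h2 := exp_quad (x := -S.eta) (by
    rw [abs_neg, abs_of_pos S.eta_pos]
    have := S.eta_le; have := S.hβ; linarith)
  nlinarith

set_option maxHeartbeats 1000000 in
lemma e3 {v : V} (hv : v ∈ S.U) :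
    Pr S.w (fun ω => ∑ u ∈ S.Nb v, S.a v u * ind (S.Act ω u) ≤
      (S.eta - S.eta ^ 2) * ∑ c ∈ S.L v, ((S.Nc v c).card : ℝ) - S.tau * S.ell v * S.T)
      ≤ Real.exp (-(S.β ^ 3 * S.p / 4)) := by
  have hT := S.T_pos
  have hb := S.hβ0
  have hl := S.ell_pos hv
  have h := tail_lower_indep S.w_isW ((S.Nb v).map Two.inlE)
    (Two.onL fun u row => S.a v u * ind (∃ c ∈ S.P u, row c = true)) (S.ell v)
    (S.β / (2 * S.ell v)) (S.tau / 2 * S.ell v * S.T) (by positivity)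
    (by field_simp; have := S.hβ; linarith)
    (by
      intro i hi; obtain ⟨u, -, rfl⟩ := mem_map.1 hi
      intro row; exact mul_nonneg (S.a_nonneg _ _) (ind_nonneg _))
    (by
      intro i hi; obtain ⟨u, -, rfl⟩ := mem_map.1 hi
      intro row
      exact (mul_le_of_le_one_right (S.a_nonneg _ _) (ind_le_one _)).trans (S.a_le v u))
    (Two.onL fun u => S.a v u * (S.eta - S.eta ^ 2))
    (by
      intro i hi; obtain ⟨u, -, rfl⟩ := mem_map.1 hi
      change S.a v u * (S.eta - S.eta ^ 2) ≤ Ex (fun c => bw (S.pr (Two.inl u) c))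
        (fun row => S.a v u * ind (∃ c ∈ S.P u, row c = true))
      rw [Ex_smul]
      by_cases hu : u ∈ S.U
      · exact mul_le_mul_of_nonneg_left (S.act_ge hu) (S.a_nonneg _ _)
      · have : S.a v u = 0 := by unfold a; rw [S.hLU u hu]; simp
        rw [this]; simp)
  refine (Pr_mono S.w_isW ?_).trans (h.trans ?_)
  · intro ω hω
    rw [Finset.sum_map, Finset.sum_map]
    refine le_trans hω ?_
    have e : ∑ u ∈ S.Nb v, Two.onL (fun u => S.a v u * (S.eta - S.eta ^ 2)) (Two.inlE u)
        = (S.eta - S.eta ^ 2) * ∑ c ∈ S.L v, ((S.Nc v c).card : ℝ) := by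
      rw [← S.sum_a, Finset.mul_sum]
      exact Finset.sum_congr rfl fun u _ => mul_comm _ _
    rw [e]
    have e1 : S.β / (2 * S.ell v) * S.ell v = S.β / 2 := by field_simp
    rw [e1]
    have h1 := S.sumD' hv
    set D := ∑ c ∈ S.L v, ((S.Nc v c).card : ℝ)
    have hD0 : 0 ≤ D := Finset.sum_nonneg fun _ _ => Nat.cast_nonneg _
    have h2 : S.β * ((S.eta - S.eta ^ 2) * D) ≤ S.tau * S.ell v * S.T := by
      calc S.β * ((S.eta - S.eta ^ 2) * D) ≤ S.β * (S.eta * D) := by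
            gcongr; nlinarith [sq_nonneg S.eta]
        _ = S.tau * D := by unfold tau; ring
        _ ≤ S.tau * (S.ell v * S.T) := by have := S.tau_pos; gcongr
        _ = _ := by ring
    linarith
  · refine Real.exp_le_exp.2 (neg_le_neg ?_)
    have e : S.β / (2 * S.ell v) * (S.tau / 2 * S.ell v * S.T) = S.β * (S.tau * S.T) / 4 := by
      field_simp; ring
    rw [e, S.tauT]
    apply le_of_eq; ring

lemma e9 {v : V} {c : K} (hc : c ∈ S.L v) :
    Pr S.w (fun ω => 3 * S.eta * S.T ≤ ∑ u ∈ S.Nc v c, ind (S.Act ω u))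
      ≤ Real.exp (-(S.β * S.p)) := by
  have hT := S.T_pos
  have he := S.eta_pos
  have h := tail_upper_indep S.w_isW ((S.Nc v c).map Two.inlE)
    (Two.onL fun u row => ind (∃ c ∈ S.P u, row c = true)) 1 1
    (S.eta * S.T) (by positivity) (by norm_num)
    (by
      intro i hi; obtain ⟨u, -, rfl⟩ := mem_map.1 hi
      intro row; exact (ind_nonneg _))
    (by
      intro i hi; obtain ⟨u, -, rfl⟩ := mem_map.1 hi
      intro row
      exact ind_le_one _)
    (fun _ => S.eta)
    (by
      intro i hi; obtain ⟨u, -, rfl⟩ := mem_map.1 hi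
      refine (S.act_le (u := u) (S.P u)).trans ?_
      rw [← S.lamp]
      have := S.lam_pos
      have := S.Pcard_le u
      gcongr)
  refine (Pr_mono S.w_isW ?_).trans (h.trans ?_)
  · intro ω hω
    rw [Finset.sum_const, card_map, nsmul_eq_mul, Finset.sum_map]
    refine le_trans ?_ hω
    have := S.Nc_le hc
    nlinarith
  · rw [one_mul, S.etaT]

lemma emart {v : V} (hv : v ∈ S.U) (r : V → ℕ) (hr : Function.Injective r)
    (g : V → (Two V → K → Bool) → ℝ) (Q : V → (Two V → K → Bool) → Finset K)
    (hg0 : ∀ u ω, 0 ≤ g u ω) (hg1 : ∀ u ω, g u ω ≤ S.ell v)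
    (hg : ∀ u w, r u ≤ r w → ∀ ω a, g u (Function.update ω (Two.inl w) a) = g u ω)
    (hQ : ∀ u w, r u ≤ r w → ∀ ω a, Q u (Function.update ω (Two.inl w) a) = Q u ω) :
    Pr S.w (fun ω => 2 * (S.lam * ∑ u ∈ S.Nb v, g u ω * (Q u ω).card) + S.tau * S.ell v * S.T ≤
      ∑ u ∈ S.Nb v, g u ω * ind (∃ c ∈ Q u ω, ω (Two.inl u) c = true))
      ≤ Real.exp (-(S.tau * S.T)) := by
  have hT := S.T_pos
  have hl := S.ell_pos hv
  have ht := S.tau_pos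
  have h := tail_upper S.w_isW (Two.onL r) ((S.Nb v).map Two.inlE)
    (by
      intro i hi j hj hij
      obtain ⟨u, -, rfl⟩ := mem_map.1 hi
      obtain ⟨u', -, rfl⟩ := mem_map.1 hj
      rw [hr hij])
    (Two.onL fun u ω => g u ω * ind (∃ c ∈ Q u ω, ω (Two.inl u) c = true))
    (Two.onL fun u ω => S.lam * (g u ω * (Q u ω).card)) (S.ell v) (1 / S.ell v)
    (S.tau * S.ell v * S.T) (by positivity) (by field_simp; exact le_rfl)
    (by
      intro i hi; obtain ⟨u, -, rfl⟩ := mem_map.1 hi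
      intro ω; exact mul_nonneg (hg0 _ _) (ind_nonneg _))
    (by
      intro i hi; obtain ⟨u, -, rfl⟩ := mem_map.1 hi
      intro ω
      exact (mul_le_of_le_one_right (hg0 _ _) (ind_le_one _)).trans (hg1 u ω))
    (by
      intro i hi j hj hij ω b
      obtain ⟨u, -, rfl⟩ := mem_map.1 hi
      obtain ⟨u', -, rfl⟩ := mem_map.1 hj
      have hij' : r u < r u' := hij
      change g u _ * ind (∃ c ∈ Q u _, Function.update ω (Two.inl u') b (Two.inl u) c = true) = _
      rw [Two.inlE_apply, hg u u' hij'.le, hQ u u' hij'.le, Function.update_of_ne]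
      · rfl
      · intro h; cases h; exact lt_irrefl _ hij')
    (by
      intro i hi j hj hij ω b
      obtain ⟨u, -, rfl⟩ := mem_map.1 hi
      obtain ⟨u', -, rfl⟩ := mem_map.1 hj
      have hij' : r u ≤ r u' := hij
      change S.lam * (g u _ * (Q u _).card) = _
      rw [Two.inlE_apply, hg u u' hij', hQ u u' hij']
      rfl)
    (by
      intro i hi ω; obtain ⟨u, -, rfl⟩ := mem_map.1 hi
      change ∑ b, S.w (Two.inl u) b * (g u (Function.update ω (Two.inl u) b) *
        ind (∃ c ∈ Q u (Function.update ω (Two.inl u) b),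
          Function.update ω (Two.inl u) b (Two.inl u) c = true)) ≤ S.lam * (g u ω * (Q u ω).card)
      simp only [hg u u le_rfl, hQ u u le_rfl, Function.update_self]
      change Ex (fun c => bw (S.pr (Two.inl u) c))
        (fun row => g u ω * ind (∃ c ∈ Q u ω, row c = true)) ≤ _
      rw [Ex_smul]
      have := mul_le_mul_of_nonneg_left (S.act_le (u := u) (Q u ω)) (hg0 u ω)
      linarith)
  refine (Pr_mono S.w_isW ?_).trans (h.trans ?_)
  · intro ω hω
    rw [Finset.sum_map, Finset.sum_map]
    refine le_trans (le_of_eq ?_) hω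
    have e1 : 1 / S.ell v * S.ell v = 1 := by field_simp
    rw [e1]
    simp only [Two.onL, Two.inlE_apply]
    rw [← Finset.mul_sum]
    ring
  · refine Real.exp_le_exp.2 (neg_le_neg ?_)
    apply le_of_eq
    field_simp

end Ctx

namespace Ctx
variable {V K : Type} [Fintype V] [Fintype K] (S : Ctx V K)

/-- hit by a smaller rank neighbour -/
def hitR (r : V → ℕ) (ω : Two V → K → Bool) (u : V) (c : K) : Prop :=
  ∃ w ∈ S.NP u c, r w < r u ∧ ω (Two.inl w) c = true
def R (r : V → ℕ) (u : V) (ω : Two V → K → Bool) : Finset K := (S.P u).filter (S.hitR r ω u)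
def Conf (r : V → ℕ) (ω : Two V → K → Bool) (u : V) : Prop :=
  ∃ c ∈ S.R r u ω, ω (Two.inl u) c = true
def Col (r : V → ℕ) (ω : Two V → K → Bool) (u : V) : Prop :=
  ∃ c ∈ S.P u, ω (Two.inl u) c = true ∧ ¬ S.hitR r ω u c
def hm (r : V → ℕ) (v u : V) (ω : Two V → K → Bool) : ℝ :=
  ∑ c ∈ S.L u ∩ S.L v, ind (ω (Two.inr u) c = false ∨ S.hitR r ω u c)

lemma hitR_update (r : V → ℕ) {u w : V} (h : r u ≤ r w) (ω : Two V → K → Bool) (a : K → Bool) :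
    S.hitR r (Function.update ω (Two.inl w) a) u = S.hitR r ω u := by
  ext c
  unfold hitR
  refine exists_congr fun x => and_congr_right fun _ => and_congr_right fun hx => ?_
  rw [Function.update_of_ne]
  intro h'; cases h'; omega

lemma hm_nonneg (r : V → ℕ) (v u : V) (ω : Two V → K → Bool) : 0 ≤ S.hm r v u ω :=
  Finset.sum_nonneg fun _ _ => ind_nonneg _

lemma e4 {v : V} (hv : v ∈ S.U) (r : V → ℕ) (hr : Function.Injective r) :
    Pr S.w (fun ω => 2 * (S.lam * ∑ u ∈ S.Nb v, S.a v u * (S.R r u ω).card)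
      + S.tau * S.ell v * S.T ≤ ∑ u ∈ S.Nb v, S.a v u * ind (S.Conf r ω u))
      ≤ Real.exp (-(S.tau * S.T)) := by
  refine S.emart hv r hr (fun u _ => S.a v u) (S.R r) (fun u _ => S.a_nonneg v u)
    (fun u _ => S.a_le v u) (fun _ _ _ _ _ => rfl) ?_
  intro u w h ω a
  unfold R
  rw [S.hitR_update r h]

lemma e6 {v : V} (hv : v ∈ S.U) (r : V → ℕ) (hr : Function.Injective r) :
    Pr S.w (fun ω => 2 * (S.lam * ∑ u ∈ S.Nb v, S.hm r v u ω * (S.P u).card)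
      + S.tau * S.ell v * S.T ≤ ∑ u ∈ S.Nb v, S.hm r v u ω * ind (S.Act ω u))
      ≤ Real.exp (-(S.tau * S.T)) := by
  refine S.emart hv r hr (fun u => S.hm r v u) (fun u _ => S.P u) (fun u ω => S.hm_nonneg r v u ω)
    ?_ ?_ (fun _ _ _ _ _ => rfl)
  · intro u ω
    refine le_trans ?_ (S.a_le v u)
    refine (Finset.sum_le_sum fun c _ => ind_le_one _).trans ?_
    simp [a]
  · intro u w h ω a
    unfold hm
    rw [S.hitR_update r h]
    refine Finset.sum_congr rfl fun c _ => ?_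
    rw [Function.update_of_ne]
    intro h'; cases h'

/-- good events -/
structure Good (r r' : V → ℕ) (v : V) (ω : Two V → K → Bool) : Prop where
  g1 : ¬ (∑ c ∈ S.L v, ind (S.Surv ω v c) ≤ (S.kap - S.tau) * S.ell v)
  g2 : ¬ (S.kap ^ 2 * ∑ c ∈ S.L v, ((S.Nc v c).card : ℝ) + 3 * S.tau * S.ell v * S.T
        ≤ ∑ c ∈ S.L v, ∑ u ∈ S.Nc v c, ind (S.Surv ω u c ∧ S.Surv ω v c))
  g3 : ¬ (∑ u ∈ S.Nb v, S.a v u * ind (S.Act ω u) ≤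
      (S.eta - S.eta ^ 2) * ∑ c ∈ S.L v, ((S.Nc v c).card : ℝ) - S.tau * S.ell v * S.T)
  g4 : ¬ (2 * (S.lam * ∑ u ∈ S.Nb v, S.a v u * (S.R r u ω).card)
      + S.tau * S.ell v * S.T ≤ ∑ u ∈ S.Nb v, S.a v u * ind (S.Conf r ω u))
  g6 : ¬ (2 * (S.lam * ∑ u ∈ S.Nb v, S.hm r v u ω * (S.P u).card)
      + S.tau * S.ell v * S.T ≤ ∑ u ∈ S.Nb v, S.hm r v u ω * ind (S.Act ω u))
  g7 : ¬ (2 * (S.lam * ∑ u ∈ S.Nb v, S.hm r' v u ω * (S.P u).card)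
      + S.tau * S.ell v * S.T ≤ ∑ u ∈ S.Nb v, S.hm r' v u ω * ind (S.Act ω u))
  g8 : ¬ (3 * S.β * S.ell v * S.T ≤ ∑ c ∈ S.L v, ∑ u ∈ S.Nc v c, ind (¬ S.Surv ω u c))
  g5 : ¬ ∃ u ∈ (S.Nb v).filter (fun u => u ∈ S.U),
    3 * S.β * S.p ≤ ∑ c ∈ S.P u, ind (S.Hit ω u c)
  g9 : ¬ ∃ c ∈ S.L v, 3 * S.eta * S.T ≤ ∑ u ∈ S.Nc v c, ind (S.Act ω u)

lemma Nb_card (v : V) : (S.Nb v).card ≤ S.Δ := by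
  refine le_trans (le_of_eq ?_) (S.hΔ v)
  unfold Nb
  rw [← SimpleGraph.card_neighborFinset_eq_degree]
  congr 1; ext u; simp

lemma good_prob {v : V} (hv : v ∈ S.U) (r r' : V → ℕ) (hr : Function.Injective r)
    (hr' : Function.Injective r') (ρ : ℝ) (hρ : 1 ≤ ρ) (hTρ : S.T ≤ ρ * S.p) :
    Pr S.w (fun ω => ¬ S.Good r r' v ω)
      ≤ (S.Δ + Fintype.card K + 7) * Real.exp (-(S.β ^ 4 * S.p / (8 * ρ ^ 2))) := by
  set x := Real.exp (-(S.β ^ 4 * S.p / (8 * ρ ^ 2))) with hx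
  have hx0 : 0 < x := Real.exp_pos _
  have hb := S.hβ0
  have hb1 : S.β ≤ 1 := by linarith [S.hβ]
  have hp := S.p_pos
  have hw := S.w_isW
  have c1 : S.β ^ 4 * S.p / (8 * ρ ^ 2) ≤ S.tau ^ 2 * S.p / 8 := by
    have : S.β ^ 2 / ρ ≤ S.tau := by
      rw [div_le_iff₀ (by linarith)]
      have h1 := S.tauT
      have h2 : S.β ^ 2 * S.p ≤ S.tau * (ρ * S.p) := by
        rw [← h1]; have := S.tau_pos; gcongr
      have h3 : S.β ^ 2 * S.p ≤ (S.tau * ρ) * S.p := by linarith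
      exact le_of_mul_le_mul_right h3 hp
    have h2 : (S.β ^ 2 / ρ) ^ 2 ≤ S.tau ^ 2 := by
      have : 0 ≤ S.β ^ 2 / ρ := by positivity
      gcongr
    calc S.β ^ 4 * S.p / (8 * ρ ^ 2) = (S.β ^ 2 / ρ) ^ 2 * S.p / 8 := by
          field_simp
      _ ≤ _ := by gcongr
  have c0 : S.β ^ 4 * S.p / (8 * ρ ^ 2) ≤ S.β ^ 4 * S.p / 8 := by
    have : (1:ℝ) ≤ ρ ^ 2 := by nlinarith
    gcongr; linarith
  have b43 : S.β ^ 4 ≤ S.β ^ 3 := pow_le_pow_of_le_one hb.le hb1 (by norm_num)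
  have b42 : S.β ^ 4 ≤ S.β ^ 2 := pow_le_pow_of_le_one hb.le hb1 (by norm_num)
  have b41 : S.β ^ 4 ≤ S.β := by
    have := pow_le_pow_of_le_one hb.le hb1 (show 1 ≤ 4 by norm_num); simpa using this
  have b4 : 0 ≤ S.β ^ 4 := by positivity
  have x1 : Real.exp (-(S.tau ^ 2 * S.p / 8)) ≤ x := Real.exp_le_exp.2 (neg_le_neg c1)
  have x2 : Real.exp (-(S.β ^ 3 * S.p / 4)) ≤ x := Real.exp_le_exp.2 (neg_le_neg (by nlinarith))
  have x3 : Real.exp (-(S.tau * S.T)) ≤ x := Real.exp_le_exp.2 (neg_le_neg (by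
    rw [S.tauT]; nlinarith))
  have x4 : Real.exp (-(S.β * S.p)) ≤ x := Real.exp_le_exp.2 (neg_le_neg (by nlinarith))
  have y5 : Pr S.w (fun ω => ∃ u ∈ (S.Nb v).filter (fun u => u ∈ S.U),
    3 * S.β * S.p ≤ ∑ c ∈ S.P u, ind (S.Hit ω u c)) ≤ S.Δ * x := by
    refine (Pr_exists hw _ _).trans ?_
    refine (Finset.sum_le_card_nsmul _ _ x fun u hu => (S.e5 (mem_filter.1 hu).2).trans x4).trans ?_
    rw [nsmul_eq_mul]
    gcongr
    exact (Finset.card_filter_le _ _).trans (S.Nb_card v)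
  have y9 : Pr S.w (fun ω => ∃ c ∈ S.L v, 3 * S.eta * S.T ≤ ∑ u ∈ S.Nc v c, ind (S.Act ω u))
      ≤ Fintype.card K * x := by
    refine (Pr_exists hw _ _).trans ?_
    refine (Finset.sum_le_card_nsmul _ _ x fun u hu => (S.e9 hu).trans x4).trans ?_
    rw [nsmul_eq_mul]
    gcongr
    exact Finset.card_le_univ _
  have y1 := (S.e1 hv).trans x1
  have y2 := (S.e2 hv).trans x1
  have y3 := (S.e3 hv).trans x2
  have y4 := (S.e4 hv r hr).trans x3
  have y6 := (S.e6 hv r hr).trans x3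
  have y7 := (S.e6 hv r' hr').trans x3
  have y8 := (S.e8 hv).trans x4
  have key : ∀ ω, ¬ S.Good r r' v ω → _ := fun ω h => by
    have h' : ¬ (_ ∧ _ ∧ _ ∧ _ ∧ _ ∧ _ ∧ _ ∧ _ ∧ _) := fun ⟨a1, a2, a3, a4, a5, a6, a7, a8, a9⟩ =>
      h ⟨a1, a2, a3, a4, a5, a6, a7, a8, a9⟩
    simp only [not_and_or, not_not] at h'
    exact h'
  refine (Pr_mono hw key).trans ?_
  refine (Pr_or hw _ _).trans ?_
  refine (add_le_add_right ((Pr_or hw _ _).trans (add_le_add_right ((Pr_or hw _ _).trans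
    (add_le_add_right ((Pr_or hw _ _).trans (add_le_add_right ((Pr_or hw _ _).trans
    (add_le_add_right ((Pr_or hw _ _).trans (add_le_add_right ((Pr_or hw _ _).trans
    (add_le_add_right (Pr_or hw _ _) _)) _)) _)) _)) _)) _)) _).trans ?_
  linarith

/-- new degree -/
def Dn (r : V → ℕ) (ω : Two V → K → Bool) (v : V) (c : K) : ℝ :=
  ∑ u ∈ S.Nc v c, ind (S.Surv ω u c ∧ ¬ S.Col r ω u)

/-- new threshold -/
def Tn : ℝ := S.kap * S.T * (1 - S.eta + 50 * S.tau)

lemma col_of {r : V → ℕ} {ω : Two V → K → Bool} {u : V} (h : S.Act ω u) (h' : ¬ S.Conf r ω u) :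
    S.Col r ω u := by
  obtain ⟨c, hc, hp⟩ := h
  refine ⟨c, hc, hp, fun hh => h' ⟨c, mem_filter.2 ⟨hc, hh⟩, hp⟩⟩

lemma not_surv {r r' : V → ℕ} {ω : Two V → K → Bool} {u : V} {c : K}
    (hr : Function.Injective r) (hrr : ∀ u w, r u < r w → r' w < r' u)
    (h : ¬ S.Surv ω u c) : (ω (Two.inr u) c = false ∨ S.hitR r ω u c) ∨ S.hitR r' ω u c := by
  by_contra hc
  push Not at hc
  obtain ⟨⟨h1, h2⟩, h3⟩ := hc
  apply h
  refine ⟨by simpa using h1, fun w hw => ?_⟩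
  by_contra hb
  have hb' : ω (Two.inl w) c = true := by simpa using hb
  have hne : w ≠ u := by rintro rfl; exact (S.mem_NP.1 hw).1.ne rfl
  rcases lt_trichotomy (r w) (r u) with hlt | heq | hgt
  · exact h2 ⟨w, hw, hlt, hb'⟩
  · exact hne (hr heq)
  · exact h3 ⟨w, hw, hrr u w hgt, hb'⟩

lemma surv_not {r : V → ℕ} {ω : Two V → K → Bool} {u : V} {c : K}
    (h : ω (Two.inr u) c = false ∨ S.hitR r ω u c) : ¬ S.Surv ω u c := by
  rintro ⟨h1, h2⟩
  rcases h with h | ⟨w, hw, -, hb⟩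
  · have : ω (Two.inr u) c = true := h1
    rw [h] at this; simp at this
  · have : ω (Two.inl w) c = false := h2 w hw
    rw [hb] at this; simp at this

lemma hm_sum (r : V → ℕ) (ω : Two V → K → Bool) (v : V) :
    S.lam * ∑ u ∈ S.Nb v, S.hm r v u ω * (S.P u).card
      ≤ S.eta * ∑ c ∈ S.L v, ∑ u ∈ S.Nc v c, ind (¬ S.Surv ω u c) := by
  rw [← S.dbl v (fun u c => ind (¬ S.Surv ω u c)), ← S.lamp, mul_assoc]
  have := S.lam_pos
  refine mul_le_mul_of_nonneg_left ?_ this.le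
  rw [Finset.mul_sum]
  refine Finset.sum_le_sum fun u _ => ?_
  rw [mul_comm]
  refine mul_le_mul (S.Pcard_le u) ?_ (S.hm_nonneg r v u ω) S.p_pos.le
  exact Finset.sum_le_sum fun c _ => ind_mono (S.surv_not (r := r))

lemma R_le {r r' : V → ℕ} {v u : V} {ω : Two V → K → Bool} (hg : S.Good r r' v ω)
    (hu : u ∈ S.Nb v) : ((S.R r u ω).card : ℝ) ≤ 3 * S.β * S.p := by
  by_cases hU : u ∈ S.U
  · have h := hg.g5
    push Not at h
    refine le_trans ?_ (h u (mem_filter.2 ⟨hu, hU⟩)).le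
    unfold R
    rw [Finset.card_filter]
    push_cast
    refine Finset.sum_le_sum fun c _ => ?_
    split_ifs with h
    · obtain ⟨w, hw, -, hb⟩ := h
      rw [ind_true ⟨w, hw, hb⟩]
    · exact ind_nonneg _
  · have : S.P u = ∅ := by
      have := S.hPL u; rw [S.hLU u hU] at this; exact Finset.subset_empty.1 this
    unfold R
    rw [this]
    have := S.hβ0; have := S.p_pos
    simp; positivity

set_option maxHeartbeats 2000000 in
lemma good_main {r r' : V → ℕ} (hr : Function.Injective r)
    (hrr : ∀ u w, r u < r w → r' w < r' u) {v : V} (hv : v ∈ S.U) {ω : Two V → K → Bool}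
    (hg : S.Good r r' v ω) (p' : ℝ) (hp' : p' ≤ S.kap * (1 - 100 * S.tau) * S.p) :
    p' * S.Tn ≤ ∑ c ∈ S.L v, ind (S.Surv ω v c) * (S.Tn - S.Dn r ω v c) := by
  have hT := S.T_pos
  have ht := S.tau_pos
  have hl := S.ell_pos hv
  have he := S.eta_pos
  have hb := S.hβ0
  have hb1 := S.hβ
  have he1 := S.eta_le
  have g1 := not_le.1 hg.g1
  have g2 := not_le.1 hg.g2
  have g3 := not_le.1 hg.g3
  have g4 := not_le.1 hg.g4
  have g6 := not_le.1 hg.g6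
  have g7 := not_le.1 hg.g7
  have g8 := not_le.1 hg.g8
  have g9 := hg.g9
  push Not at g9
  have hD := S.sumD hv
  have hD' := S.sumD' hv
  set SD := ∑ c ∈ S.L v, ((S.Nc v c).card : ℝ) with hSD
  have hSD0 : 0 ≤ SD := Finset.sum_nonneg fun _ _ => Nat.cast_nonneg _
  set W1 := ∑ c ∈ S.L v, ∑ u ∈ S.Nc v c, ind (S.Surv ω u c ∧ S.Surv ω v c)
  set Z := ∑ c ∈ S.L v, ∑ u ∈ S.Nc v c, ind (¬ S.Surv ω u c)
  set SV := ∑ c ∈ S.L v, ind (S.Surv ω v c) with hSVdef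
  -- W bound
  have hW : ∑ c ∈ S.L v, ind (S.Surv ω v c) * S.Dn r ω v c ≤
      ∑ c ∈ S.L v, ∑ u ∈ S.Nc v c, (ind (S.Surv ω u c ∧ S.Surv ω v c) - ind (S.Act ω u)
        + ind (S.Conf r ω u) + ind (S.Act ω u) * ind (¬ S.Surv ω u c)
        + ind (¬ S.Surv ω v c) * ind (S.Act ω u)) := by
    refine Finset.sum_le_sum fun c _ => ?_
    unfold Dn
    rw [Finset.mul_sum]
    refine Finset.sum_le_sum fun u _ => ?_
    rw [ind_and, ind_and, ind_not, ind_not, ind_not]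
    have hcol : ind (S.Act ω u) - ind (S.Conf r ω u) ≤ ind (S.Col r ω u) := by
      by_cases h1 : S.Act ω u
      · by_cases h2 : S.Conf r ω u
        · rw [ind_true h1, ind_true h2]; linarith [ind_nonneg (S.Col r ω u)]
        · rw [ind_true (S.col_of h1 h2)]
          linarith [ind_le_one (S.Act ω u), ind_nonneg (S.Conf r ω u)]
      · rw [ind_false h1]; linarith [ind_nonneg (S.Col r ω u), ind_nonneg (S.Conf r ω u)]
    have a0 := ind_nonneg (S.Act ω u)
    have f0 := ind_nonneg (S.Conf r ω u)
    by_cases h1 : S.Surv ω u c <;> by_cases h2 : S.Surv ω v c <;>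
      simp only [ind_true, ind_false, h1, h2, not_false_iff] <;> linarith
  have hW2 : ∑ c ∈ S.L v, ∑ u ∈ S.Nc v c, (ind (S.Surv ω u c ∧ S.Surv ω v c) - ind (S.Act ω u)
        + ind (S.Conf r ω u) + ind (S.Act ω u) * ind (¬ S.Surv ω u c)
        + ind (¬ S.Surv ω v c) * ind (S.Act ω u))
      = W1 - ∑ u ∈ S.Nb v, S.a v u * ind (S.Act ω u) + ∑ u ∈ S.Nb v, S.a v u * ind (S.Conf r ω u)
        + ∑ u ∈ S.Nb v, ∑ c ∈ S.L u ∩ S.L v, ind (S.Act ω u) * ind (¬ S.Surv ω u c)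
        + ∑ c ∈ S.L v, ind (¬ S.Surv ω v c) * ∑ u ∈ S.Nc v c, ind (S.Act ω u) := by
    have q1 : ∑ u ∈ S.Nb v, S.a v u * ind (S.Act ω u)
        = ∑ c ∈ S.L v, ∑ u ∈ S.Nc v c, ind (S.Act ω u) := by
      rw [← S.dbl v (fun u _ => ind (S.Act ω u))]
      simp [a]
    have q2 : ∑ u ∈ S.Nb v, S.a v u * ind (S.Conf r ω u)
        = ∑ c ∈ S.L v, ∑ u ∈ S.Nc v c, ind (S.Conf r ω u) := by
      rw [← S.dbl v (fun u _ => ind (S.Conf r ω u))]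
      simp [a]
    rw [q1, q2, S.dbl v (fun u c => ind (S.Act ω u) * ind (¬ S.Surv ω u c))]
    simp only [Finset.sum_add_distrib, Finset.sum_sub_distrib, Finset.mul_sum]
    rfl
  have hW3 : ∑ u ∈ S.Nb v, ∑ c ∈ S.L u ∩ S.L v, ind (S.Act ω u) * ind (¬ S.Surv ω u c)
      ≤ ∑ u ∈ S.Nb v, S.hm r v u ω * ind (S.Act ω u)
        + ∑ u ∈ S.Nb v, S.hm r' v u ω * ind (S.Act ω u) := by
    rw [← Finset.sum_add_distrib]
    refine Finset.sum_le_sum fun u _ => ?_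
    rw [← Finset.mul_sum, ← add_mul, mul_comm]
    refine mul_le_mul_of_nonneg_right ?_ (ind_nonneg _)
    unfold hm
    rw [← Finset.sum_add_distrib]
    refine Finset.sum_le_sum fun c _ => ?_
    by_cases h : S.Surv ω u c
    · rw [ind_false (not_not.2 h)]; exact add_nonneg (ind_nonneg _) (ind_nonneg _)
    · rcases S.not_surv hr hrr h with h' | h'
      · rw [ind_true h, ind_true h']; linarith [ind_nonneg (ω (Two.inr u) c = false ∨ S.hitR r' ω u c)]
      · rw [ind_true h, ind_true (P := ω (Two.inr u) c = false ∨ S.hitR r' ω u c) (Or.inr h')]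
        linarith [ind_nonneg (ω (Two.inr u) c = false ∨ S.hitR r ω u c)]
  have hW4 : ∑ c ∈ S.L v, ind (¬ S.Surv ω v c) * ∑ u ∈ S.Nc v c, ind (S.Act ω u)
      ≤ (S.ell v - SV) * (3 * S.eta * S.T) := by
    have : S.ell v - SV = ∑ c ∈ S.L v, ind (¬ S.Surv ω v c) := by
      simp only [ind_not, Finset.sum_sub_distrib]
      simp [ell, SV]
    rw [this, Finset.sum_mul]
    exact Finset.sum_le_sum fun c hc => mul_le_mul_of_nonneg_left (g9 c hc).le (ind_nonneg _)
  have hm1 : _ ≤ S.eta * Z := S.hm_sum r ω v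
  have hm2 : _ ≤ S.eta * Z := S.hm_sum r' ω v
  rw [hW2] at hW
  clear hW2
  clear_value SD W1 Z SV
  have hZ : S.eta * Z ≤ 3 * S.tau * S.ell v * S.T := by
    calc S.eta * Z ≤ S.eta * (3 * S.β * S.ell v * S.T) := by gcongr
      _ = _ := by unfold tau; ring
  have hR : S.lam * ∑ u ∈ S.Nb v, S.a v u * (S.R r u ω).card ≤ 3 * S.tau * (S.ell v * S.T) := by
    have h1 : ∑ u ∈ S.Nb v, S.a v u * (S.R r u ω).card ≤ ∑ u ∈ S.Nb v, S.a v u * (3 * S.β * S.p) :=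
      Finset.sum_le_sum fun u hu => mul_le_mul_of_nonneg_left (S.R_le hg hu) (S.a_nonneg v u)
    rw [← Finset.sum_mul, S.sum_a] at h1
    have h2 := mul_le_mul_of_nonneg_left h1 S.lam_pos.le
    refine h2.trans ?_
    have : S.lam * (SD * (3 * S.β * S.p)) = 3 * S.tau * SD := by
      unfold tau; rw [← S.lamp]; ring
    rw [← hSD, this]
    gcongr
  have hSV : (S.ell v - SV) * (3 * S.eta * S.T) ≤ 4 * S.tau * S.ell v * S.T := by
    have h1 : S.ell v - SV ≤ (4 / 3) * S.β * S.ell v := by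
      have h2 : S.tau ≤ S.β / 3 := by have := S.tau_le; nlinarith
      have h3 : S.ell v - SV ≤ (S.β + S.tau) * S.ell v := by unfold kap at g1; linarith
      refine h3.trans ?_
      gcongr; linarith
    calc (S.ell v - SV) * (3 * S.eta * S.T) ≤ ((4 / 3) * S.β * S.ell v) * (3 * S.eta * S.T) := by
          gcongr
      _ = _ := by unfold tau; ring
  have hE2 : S.eta ^ 2 * SD ≤ 16 * S.tau * (S.ell v * S.T) := by
    have : S.eta ^ 2 ≤ 16 * S.tau := by unfold tau; nlinarith
    calc S.eta ^ 2 * SD ≤ (16 * S.tau) * SD := by gcongr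
      _ ≤ _ := by gcongr
  -- collect
  have hWf : ∑ c ∈ S.L v, ind (S.Surv ω v c) * S.Dn r ω v c
      ≤ (S.kap ^ 2 - S.eta) * SD + 46 * (S.tau * (S.ell v * S.T)) := by
    have pos : 0 < S.tau * (S.ell v * S.T) := by positivity
    linarith
  have hk0 := S.kap_pos
  have hk1 := S.kap_le
  have t1 : S.tau ≤ 1 / 10000 := by have := S.tau_le; nlinarith
  have hke : 0 ≤ S.kap ^ 2 - S.eta := by unfold kap; nlinarith
  have hWg : ∑ c ∈ S.L v, ind (S.Surv ω v c) * S.Dn r ω v c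
      ≤ (S.kap ^ 2 - S.eta) * ((S.ell v - S.p) * S.T) + 46 * (S.tau * (S.ell v * S.T)) := by
    have := mul_le_mul_of_nonneg_left hD hke
    linarith
  simp only [mul_sub]
  rw [Finset.sum_sub_distrib, ← Finset.sum_mul, ← hSVdef]
  have g0 : 0 ≤ S.eta - 50 * S.tau := by
    have : S.eta - 50 * S.tau = S.eta * (1 - 50 * S.β) := by unfold tau; ring
    rw [this]; apply mul_nonneg he.le; linarith
  set g := S.eta - 50 * S.tau with hgdef
  have hTn : S.Tn = S.kap * S.T * (1 - g) := by unfold Tn; rw [hgdef]; ring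
  have g1' : g ≤ 1 / 10 := by rw [hgdef]; linarith
  have hTn0 : 0 < S.Tn := by
    rw [hTn]; apply mul_pos (mul_pos hk0 hT); linarith
  have f1 : p' * S.Tn ≤ S.kap * (1 - 100 * S.tau) * S.p * S.Tn := by gcongr
  have f2 : (S.kap - S.tau) * S.ell v * S.Tn ≤ SV * S.Tn := by gcongr
  have hpl := S.p_le_ell hv
  have hp0 := S.p_pos
  have f3 : S.tau * S.ell v * S.Tn ≤ S.tau * (S.ell v * S.T) := by
    have : S.Tn ≤ S.T := by
      rw [hTn]
      calc S.kap * S.T * (1 - g) ≤ 1 * S.T * 1 := by gcongr <;> linarith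
        _ = S.T := by ring
    calc S.tau * S.ell v * S.Tn ≤ S.tau * S.ell v * S.T := by gcongr
      _ = _ := by ring
  -- scaled inequality
  have core : 47 * S.tau * S.ell v ≤ (S.ell v - S.p) * (S.eta - S.kap ^ 2 * g)
      + S.kap ^ 2 * (1 - g) * (100 * S.tau) * S.p := by
    have k2 : S.kap ^ 2 ≤ 1 := by nlinarith
    have h1 : 50 * S.tau ≤ S.eta - S.kap ^ 2 * g := by
      have : S.kap ^ 2 * g ≤ 1 * g := by gcongr
      linarith
    have h2 : 1 / 2 ≤ S.kap ^ 2 * (1 - g) := by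
      have : 9 / 10 ≤ S.kap ^ 2 := by unfold kap; nlinarith
      nlinarith
    have h3 : (S.ell v - S.p) * (50 * S.tau) ≤ (S.ell v - S.p) * (S.eta - S.kap ^ 2 * g) :=
      mul_le_mul_of_nonneg_left h1 (by linarith)
    have h4 : 1 / 2 * (100 * S.tau) * S.p ≤ S.kap ^ 2 * (1 - g) * (100 * S.tau) * S.p := by
      gcongr
    nlinarith
  have core2 := mul_le_mul_of_nonneg_right core hT.le
  have e1 : S.kap * S.ell v * S.Tn = S.kap ^ 2 * (1 - g) * S.ell v * S.T := by rw [hTn]; ring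
  have e2 : S.kap * (1 - 100 * S.tau) * S.p * S.Tn
      = S.kap ^ 2 * (1 - g) * (1 - 100 * S.tau) * S.p * S.T := by rw [hTn]; ring
  linarith
end Ctx

/-- colorability of a partial list assignment -/
def Cb {V K : Type} (G : SimpleGraph V) (U : Finset V) (L : V → Finset K) : Prop :=
  ∃ φ : V → K, (∀ v ∈ U, φ v ∈ L v) ∧ ∀ u ∈ U, ∀ v ∈ U, G.Adj u v → φ u ≠ φ v

/-- closed neighbourhood of a set -/
def ball1 {V : Type} [Fintype V] (G : SimpleGraph V) (s : Finset V) : Finset V :=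
  s.biUnion fun v => insert v (G.neighborFinset v)

lemma mem_ball1 {V : Type} [Fintype V] {G : SimpleGraph V} {s : Finset V} {x : V} :
    x ∈ ball1 G s ↔ ∃ v ∈ s, x = v ∨ G.Adj v x := by
  simp [ball1]

lemma ball1_card {V : Type} [Fintype V] {G : SimpleGraph V} {Δ : ℕ} (h : ∀ v, G.degree v ≤ Δ)
    (s : Finset V) : (ball1 G s).card ≤ s.card * (Δ + 1) := by
  refine Finset.card_biUnion_le_card_mul _ _ _ fun v _ => ?_
  refine (Finset.card_insert_le _ _).trans ?_
  rw [SimpleGraph.card_neighborFinset_eq_degree]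
  exact Nat.add_le_add_right (h v) 1

namespace Ctx
variable {V K : Type} [Fintype V] [Fintype K] (S : Ctx V K)

/-- bad event -/
def bad (r : V → ℕ) (p' : ℕ) (v : V) (ω : Two V → K → Bool) : Prop :=
  v ∈ S.U ∧ ¬ (p' * S.Tn ≤ ∑ c ∈ S.L v, ind (S.Surv ω v c) * (S.Tn - S.Dn r ω v c))

/-- dependency rows -/
def dep (v : V) : Finset (Two V) :=
  (ball1 S.G (ball1 S.G {v})).map Two.inlE ∪ (ball1 S.G (ball1 S.G {v})).map Two.inrE

lemma mem_dep_l {v x : V} : Two.inl x ∈ S.dep v ↔ x ∈ ball1 S.G (ball1 S.G {v}) := by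
  simp [dep]
lemma mem_dep_r {v x : V} : Two.inr x ∈ S.dep v ↔ x ∈ ball1 S.G (ball1 S.G {v}) := by
  simp [dep]

lemma bad_dep (r : V → ℕ) (p' : ℕ) (v : V) (ω ω' : Two V → K → Bool)
    (h : ∀ i ∈ S.dep v, ω i = ω' i) : S.bad r p' v ω ↔ S.bad r p' v ω' := by
  have hl : ∀ x ∈ ball1 S.G (ball1 S.G {v}), ω (Two.inl x) = ω' (Two.inl x) :=
    fun x hx => h _ (S.mem_dep_l.2 hx)
  have hr : ∀ x ∈ ball1 S.G (ball1 S.G {v}), ω (Two.inr x) = ω' (Two.inr x) :=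
    fun x hx => h _ (S.mem_dep_r.2 hx)
  have hnb : ∀ u ∈ ball1 S.G {v}, ∀ x, x = u ∨ S.G.Adj u x → x ∈ ball1 S.G (ball1 S.G {v}) :=
    fun u hu x hx => mem_ball1.2 ⟨u, hu, hx⟩
  have hs : ∀ u ∈ ball1 S.G {v}, ∀ c, S.Surv ω u c ↔ S.Surv ω' u c := by
    intro u hu c
    unfold Surv SurvC
    beta_reduce
    rw [hr u (hnb u hu u (Or.inl rfl))]
    refine and_congr_right fun _ => forall_congr' fun x => forall_congr' fun hx => ?_
    rw [hl x (hnb u hu x (Or.inr (S.mem_NP.1 hx).1))]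
  have hc : ∀ u ∈ ball1 S.G {v}, S.Col r ω u ↔ S.Col r ω' u := by
    intro u hu
    unfold Col hitR
    refine exists_congr fun c => and_congr_right fun _ => ?_
    rw [hl u (hnb u hu u (Or.inl rfl))]
    refine and_congr_right fun _ => not_congr <| exists_congr fun x => and_congr_right fun hx => ?_
    rw [hl x (hnb u hu x (Or.inr (S.mem_NP.1 hx).1))]
  have hv : v ∈ ball1 S.G {v} := mem_ball1.2 ⟨v, by simp, Or.inl rfl⟩
  unfold bad
  have : ∑ c ∈ S.L v, ind (S.Surv ω v c) * (S.Tn - S.Dn r ω v c)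
      = ∑ c ∈ S.L v, ind (S.Surv ω' v c) * (S.Tn - S.Dn r ω' v c) := by
    refine Finset.sum_congr rfl fun c _ => ?_
    rw [ind_congr (hs v hv c)]
    congr 2
    unfold Dn
    refine Finset.sum_congr rfl fun u hu => ?_
    have hu' : u ∈ ball1 S.G {v} := mem_ball1.2 ⟨v, by simp, Or.inr (S.mem_Nc.1 hu).1⟩
    rw [ind_congr (and_congr (hs u hu' c) (not_congr (hc u hu')))]
  rw [this]

lemma dep_card (j : V) :
    ((univ.filter fun i => ¬ Disjoint (S.dep i) (S.dep j)).card) ≤ (S.Δ + 1) ^ 4 := by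
  have hsub : (univ.filter fun i => ¬ Disjoint (S.dep i) (S.dep j)) ⊆
      ball1 S.G (ball1 S.G (ball1 S.G (ball1 S.G {j}))) := by
    intro i hi
    have hi := (mem_filter.1 hi).2
    rw [Finset.not_disjoint_iff] at hi
    obtain ⟨x, hx1, hx2⟩ := hi
    have : ∃ x : V, x ∈ ball1 S.G (ball1 S.G {i}) ∧ x ∈ ball1 S.G (ball1 S.G {j}) := by
      cases x with
      | inl x => exact ⟨x, S.mem_dep_l.1 hx1, S.mem_dep_l.1 hx2⟩
      | inr x => exact ⟨x, S.mem_dep_r.1 hx1, S.mem_dep_r.1 hx2⟩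
    obtain ⟨x, h1, h2⟩ := this
    obtain ⟨y, hy, hxy⟩ := mem_ball1.1 h1
    obtain ⟨z, hz, hyz⟩ := mem_ball1.1 hy
    rw [mem_singleton] at hz
    subst hz
    refine mem_ball1.2 ⟨y, mem_ball1.2 ⟨x, h2, ?_⟩, ?_⟩
    · exact hxy.imp Eq.symm fun h => h.symm
    · exact hyz.imp Eq.symm fun h => h.symm
  refine (Finset.card_le_card hsub).trans ?_
  have b := ball1_card S.hΔ
  have c1 := b {j}
  have c2 := (b (ball1 S.G {j})).trans (Nat.mul_le_mul_right _ c1)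
  have c3 := (b (ball1 S.G (ball1 S.G {j}))).trans (Nat.mul_le_mul_right _ c2)
  have c4 := (b (ball1 S.G (ball1 S.G (ball1 S.G {j})))).trans (Nat.mul_le_mul_right _ c3)
  refine c4.trans (le_of_eq ?_)
  rw [Finset.card_singleton]; ring

lemma Tn_pos : 0 < S.Tn := by
  unfold Tn
  have := S.kap_pos; have := S.T_pos; have := S.eta_le; have := S.hβ; have := S.tau_pos
  have : 0 < 1 - S.eta + 50 * S.tau := by linarith
  positivity

lemma step [Nonempty K] (ρ : ℝ) (hρ : 1 ≤ ρ) (hTρ : S.T ≤ ρ * S.p) (p' : ℕ)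
    (hp' : (p' : ℝ) ≤ S.kap * (1 - 100 * S.tau) * S.p)
    (hL : 4 * ((S.Δ + Fintype.card K + 7) * Real.exp (-(S.β ^ 4 * S.p / (8 * ρ ^ 2))))
      * ((S.Δ + 1 : ℕ) ^ 4 : ℕ) ≤ 1) :
    ∃ (U' : Finset V) (L' : V → Finset K), (∀ u, u ∉ U' → L' u = ∅) ∧
      (∀ v ∈ U', ∀ c ∈ L' v, ((nbc S.G L' v c).card : ℝ) ≤ S.Tn) ∧
      (∀ v ∈ U', (p' : ℝ) * S.Tn ≤ ∑ c ∈ L' v, (S.Tn - ((nbc S.G L' v c).card : ℝ))) ∧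
      (Cb S.G U' L' → Cb S.G S.U S.L) := by
  set N := Fintype.card V
  let e := Fintype.equivFin V
  let r : V → ℕ := fun v => (e v : ℕ)
  let r' : V → ℕ := fun v => N - 1 - (e v : ℕ)
  have hr : Function.Injective r := fun a b h => e.injective (Fin.ext h)
  have hr' : Function.Injective r' := by
    intro a b h
    apply hr
    have h1 := (e a).2; have h2 := (e b).2
    simp only [r', r] at h ⊢
    omega
  have hrr : ∀ u w, r u < r w → r' w < r' u := by
    intro u w h
    have h1 := (e u).2; have h2 := (e w).2
    simp only [r', r] at h ⊢
    omega
  have hw := S.w_isW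
  obtain ⟨ω, hω⟩ : ∃ ω, ∀ j, ¬ S.bad r p' j ω := by
    refine LLL hw (S.bad r p') S.dep (S.bad_dep r p') _ (((S.Δ + 1 : ℕ) ^ 4 : ℕ)) ?_ ?_ ?_ hL
    · intro v
      by_cases hv : v ∈ S.U
      · refine le_trans (Pr_mono hw ?_) (S.good_prob hv r r' hr hr' ρ hρ hTρ)
        intro ω hb hg
        exact hb.2 (S.good_main hr hrr hv hg p' hp')
      · refine le_trans (b := 0) ?_ (by positivity)
        unfold Pr
        rw [show (fun ω => ind (S.bad r p' v ω)) = fun _ => (0:ℝ) from ?_, Ex_const hw]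
        ext ω; exact ind_false fun h => hv h.1
    · exact_mod_cast Nat.one_le_pow _ _ (by omega)
    · intro j _
      have : (univ.filter fun i => S.bad r p' i ≠ (fun _ => False) ∧ ¬ Disjoint (S.dep i) (S.dep j)).card
        ≤ (univ.filter fun i => ¬ Disjoint (S.dep i) (S.dep j)).card :=
        Finset.card_le_card fun i hi => by
          rw [mem_filter] at hi ⊢; exact ⟨hi.1, hi.2.2⟩
      exact_mod_cast this.trans (S.dep_card j)
  let U' : Finset V := S.U.filter fun v => ¬ S.Col r ω v
  let L' : V → Finset K := fun v =>
    if v ∈ U' then (S.L v).filter fun c => S.Surv ω v c ∧ S.Dn r ω v c ≤ S.Tn else ∅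
  have hU' : ∀ v, v ∈ U' ↔ v ∈ S.U ∧ ¬ S.Col r ω v := fun v => mem_filter
  have hL' : ∀ v c, c ∈ L' v ↔ v ∈ U' ∧ c ∈ S.L v ∧ S.Surv ω v c ∧ S.Dn r ω v c ≤ S.Tn := by
    intro v c
    by_cases hv : v ∈ U'
    · simp only [L', if_pos hv, mem_filter, hv, true_and]
    · simp only [L', if_neg hv, hv, false_and, iff_false]; simp
  have hdeg : ∀ v c, ((nbc S.G L' v c).card : ℝ) ≤ S.Dn r ω v c := by
    intro v c
    have hsub : nbc S.G L' v c ⊆ (S.Nc v c).filter fun u => S.Surv ω u c ∧ ¬ S.Col r ω u := by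
      intro u hu
      have hu := (mem_filter.1 hu).2
      obtain ⟨h1, h2, h3, -⟩ := (hL' u c).1 hu.2
      exact mem_filter.2 ⟨S.mem_Nc.2 ⟨hu.1, h2⟩, h3, ((hU' u).1 h1).2⟩
    refine le_trans (Nat.cast_le.2 (Finset.card_le_card hsub)) (le_of_eq ?_)
    rw [Finset.card_filter]
    push_cast
    unfold Dn
    refine Finset.sum_congr rfl fun u _ => ?_
    split_ifs with h
    · rw [ind_true h]
    · rw [ind_false h]
  refine ⟨U', L', fun u hu => by simp only [L', if_neg hu],
    fun v _ c hc => (hdeg v c).trans ((hL' v c).1 hc).2.2.2, ?_, ?_⟩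
  · intro v hv
    have h1 := hω v
    unfold bad at h1
    push Not at h1
    refine (h1 ((hU' v).1 hv).1).trans ?_
    rw [show L' v = (S.L v).filter fun c => S.Surv ω v c ∧ S.Dn r ω v c ≤ S.Tn by
      simp only [L', if_pos hv], Finset.sum_filter]
    refine Finset.sum_le_sum fun c _ => ?_
    have hd := hdeg v c
    by_cases hs : S.Surv ω v c
    · rw [ind_true hs, one_mul]
      split_ifs with h
      · linarith
      · have : ¬ S.Dn r ω v c ≤ S.Tn := fun h' => h ⟨hs, h'⟩
        linarith
    · rw [ind_false hs, zero_mul, if_neg (fun h => hs h.1)]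
  · rintro ⟨φ, hφ1, hφ2⟩
    let ψ : V → K := fun v => if h : S.Col r ω v then h.choose else φ v
    have hψ1 : ∀ v, S.Col r ω v → ψ v ∈ S.P v ∧ ω (Two.inl v) (ψ v) = true ∧
        ¬ S.hitR r ω v (ψ v) := by
      intro v hv
      simp only [ψ, dif_pos hv]
      exact hv.choose_spec
    have hψ2 : ∀ v, ¬ S.Col r ω v → ψ v = φ v := fun v hv => by simp only [ψ, dif_neg hv]
    have k1 : ∀ u v, S.G.Adj u v → S.Col r ω u → S.Col r ω v → r u < r v → ψ u ≠ ψ v := by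
      intro u v huv hu hv hlt heq
      obtain ⟨a1, a2, a3⟩ := hψ1 u hu
      obtain ⟨b1, b2, b3⟩ := hψ1 v hv
      rw [heq] at a1 a2
      exact b3 ⟨u, S.mem_NP.2 ⟨huv.symm, a1⟩, hlt, a2⟩
    have k2 : ∀ u v, v ∈ S.U → S.G.Adj u v → S.Col r ω u → ¬ S.Col r ω v → ψ u ≠ ψ v := by
      intro u v hvU huv hu hv heq
      obtain ⟨a1, a2, a3⟩ := hψ1 u hu
      have hv' : v ∈ U' := (hU' v).2 ⟨hvU, hv⟩
      have := ((hL' v _).1 (hφ1 v hv')).2.2.1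
      rw [heq, hψ2 v hv] at a1 a2
      have h2 : ω (Two.inl u) (φ v) = false := this.2 u (S.mem_NP.2 ⟨huv.symm, a1⟩)
      rw [a2] at h2; simp at h2
    refine ⟨ψ, ?_, ?_⟩
    · intro v hv
      by_cases hc : S.Col r ω v
      · exact S.hPL v (hψ1 v hc).1
      · rw [hψ2 v hc]
        exact ((hL' v _).1 (hφ1 v ((hU' v).2 ⟨hv, hc⟩))).2.1
    · intro u hu v hv huv
      by_cases hcu : S.Col r ω u <;> by_cases hcv : S.Col r ω v
      · rcases lt_trichotomy (r u) (r v) with h | h | h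
        · exact k1 u v huv hcu hcv h
        · exact absurd (hr h) huv.ne
        · exact (k1 v u huv.symm hcv hcu h).symm
      · exact k2 u v hv huv hcu hcv
      · exact (k2 v u hu huv.symm hcv hcu).symm
      · rw [hψ2 u hcu, hψ2 v hcv]
        exact hφ2 u ((hU' u).2 ⟨hu, hcu⟩) v ((hU' v).2 ⟨hv, hcv⟩) huv
end Ctx

section fin
variable {V K : Type} [Fintype V] [Fintype K] [Nonempty K]

lemma list_card {G : SimpleGraph V} {U : Finset V} {L : V → Finset K} {p : ℕ} {T : ℝ}
    (hT0 : 0 < T) (hS : ∀ v ∈ U, (p : ℝ) * T ≤ ∑ c ∈ L v, (T - ((nbc G L v c).card : ℝ)))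
    {v : V} (hv : v ∈ U) : p ≤ (L v).card := by
  have h := hS v hv
  have h2 : ∑ c ∈ L v, (T - ((nbc G L v c).card : ℝ)) ≤ (L v).card * T := by
    rw [← nsmul_eq_mul]
    refine Finset.sum_le_card_nsmul _ _ _ fun c _ => ?_
    have : (0:ℝ) ≤ ((nbc G L v c).card : ℝ) := Nat.cast_nonneg _
    linarith
  have h3 := le_of_mul_le_mul_right (h.trans h2) hT0
  exact_mod_cast h3

lemma choose_P {G : SimpleGraph V} {U : Finset V} {L : V → Finset K} {p : ℕ} {T : ℝ}
    (hT0 : 0 < T)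
    (hS : ∀ v ∈ U, (p : ℝ) * T ≤ ∑ c ∈ L v, (T - ((nbc G L v c).card : ℝ))) :
    ∃ P : V → Finset K, (∀ u, P u ⊆ L u) ∧ ∀ u ∈ U, (P u).card = p := by
  have : ∀ u, ∃ s ⊆ L u, u ∈ U → s.card = p := by
    intro u
    by_cases hu : u ∈ U
    · obtain ⟨s, hs, hc⟩ := Finset.exists_subset_card_eq (list_card hT0 hS hu)
      exact ⟨s, hs, fun _ => hc⟩
    · exact ⟨∅, by simp, fun h => absurd h hu⟩
  choose P h1 h2 using this
  exact ⟨P, h1, h2⟩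

lemma final_LLL (G : SimpleGraph V) (U : Finset V) (L : V → Finset K) (p : ℕ) (T : ℝ)
    (hp : 2 ≤ p) (hT0 : 0 < T) (hT : T ≤ p / 16)
    (hD : ∀ v ∈ U, ∀ c ∈ L v, ((nbc G L v c).card : ℝ) ≤ T)
    (hS : ∀ v ∈ U, (p : ℝ) * T ≤ ∑ c ∈ L v, (T - ((nbc G L v c).card : ℝ))) : Cb G U L := by
  obtain ⟨P, hPL, hPc⟩ := choose_P hT0 hS
  have hp0 : (0:ℝ) < p := by exact_mod_cast (by omega : 0 < p)
  have hp2 : (2:ℝ) ≤ p := by exact_mod_cast hp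
  have he : ∀ v : V, ∃ e : Fin p → K, Function.Injective e ∧ (v ∈ U → ∀ a, e a ∈ P v) ∨ v ∉ U := by
    intro v
    by_cases hv : v ∈ U
    · let f := (Finset.equivFinOfCardEq (hPc v hv)).symm
      refine ⟨fun a => (f a : K), Or.inl ⟨?_, fun _ a => (f a).2⟩⟩
      intro a b h
      exact f.injective (Subtype.ext h)
    · exact ⟨fun _ => Classical.arbitrary K, Or.inr hv⟩
  choose e he' using he
  have he1 : ∀ v ∈ U, Function.Injective (e v) := fun v hv =>
    ((he' v).resolve_right (not_not.2 hv)).1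
  have he2 : ∀ v ∈ U, ∀ a, e v a ∈ P v := fun v hv =>
    ((he' v).resolve_right (not_not.2 hv)).2 hv
  let w : V → Fin p → ℝ := fun _ _ => 1 / (p : ℝ)
  have hw : IsW w := by
    constructor
    · intro v c
      simp only [w]; positivity
    · intro v
      simp only [w]
      rw [Finset.sum_const, nsmul_eq_mul, Finset.card_univ, Fintype.card_fin]; field_simp
  let ok : V × V × K → Prop := fun j => G.Adj j.1 j.2.1 ∧ j.1 ∈ U ∧ j.2.1 ∈ U ∧
    j.2.2 ∈ P j.1 ∧ j.2.2 ∈ P j.2.1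
  let A : V × V × K → (V → Fin p) → Prop := fun j ω =>
    ok j ∧ e j.1 (ω j.1) = j.2.2 ∧ e j.2.1 (ω j.2.1) = j.2.2
  let N : V × V × K → Finset V := fun j => {j.1, j.2.1}
  have hAok : ∀ j, A j ≠ (fun _ => False) → ok j := by
    intro j h
    by_contra hc
    exact h (by ext ω; simp [A, hc])
  let Q : V → Finset (Σ _ : K, V) := fun u => (P u).sigma fun c => nbc G L u c
  have hQ : ∀ u ∈ U, ((Q u).card : ℝ) ≤ p * T := by
    intro u hu
    rw [Finset.card_sigma]; push_cast
    refine (Finset.sum_le_card_nsmul _ _ T fun c hc => hD u hu c (hPL u hc)).trans ?_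
    rw [hPc u hu, nsmul_eq_mul]
  let M : V → Finset (V × V × K) := fun u =>
    (Q u).image (fun z => (u, z.2, z.1)) ∪ (Q u).image (fun z => (z.2, u, z.1))
  have hM : ∀ u ∈ U, ((M u).card : ℝ) ≤ 2 * (p * T) := by
    intro u hu
    have h1 : (M u).card ≤ (Q u).card + (Q u).card :=
      (Finset.card_union_le _ _).trans (add_le_add Finset.card_image_le Finset.card_image_le)
    have h2 : ((M u).card : ℝ) ≤ (Q u).card + (Q u).card := by exact_mod_cast h1
    linarith [hQ u hu]
  have hmM : ∀ j, ok j → j ∈ M j.1 ∧ j ∈ M j.2.1 := by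
    rintro ⟨u, v, c⟩ ⟨h1, h2, h3, h4, h5⟩
    constructor
    · refine mem_union_left _ (mem_image.2 ⟨⟨c, v⟩, ?_, rfl⟩)
      exact mem_sigma.2 ⟨h4, mem_filter.2 ⟨mem_univ _, h1, hPL _ h5⟩⟩
    · refine mem_union_right _ (mem_image.2 ⟨⟨c, u⟩, ?_, rfl⟩)
      exact mem_sigma.2 ⟨h5, mem_filter.2 ⟨mem_univ _, h1.symm, hPL _ h4⟩⟩
  obtain ⟨ω, hω⟩ : ∃ ω, ∀ j, ¬ (A j ω ∨ False) := by
    have := LLL hw A N ?_ (1 / (p : ℝ) ^ 2) (max 1 (4 * (p * T))) ?_ (le_max_left _ _) ?_ ?_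
    · simpa using this
    · rintro ⟨u, v, c⟩ ω ω' h
      have h1 := h u (by simp [N])
      have h2 := h v (by simp [N])
      simp only [A, h1, h2]
    · rintro ⟨u, v, c⟩
      by_cases hok : ok (u, v, c)
      · obtain ⟨h1, h2, h3, h4, h5⟩ := hok
        have hne : u ≠ v := h1.ne
        have : Pr w (A (u, v, c)) ≤ Ex w (fun ω => ∏ i, if i ∈ ({u, v} : Finset V) then
            ind (e i (ω i) = c) else 1) := by
          refine Ex_mono hw fun ω => ?_
          rw [Finset.prod_ite_mem, Finset.univ_inter, Finset.prod_pair hne, ← ind_and]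
          exact ind_mono fun h => h.2
        refine this.trans ?_
        rw [Ex_prod (w := w) (fun i a => if i ∈ ({u, v} : Finset V) then ind (e i a = c) else 1)]
        have key : ∀ i, ∑ a, w i a * (if i ∈ ({u, v} : Finset V) then ind (e i a = c) else 1)
            ≤ if i ∈ ({u, v} : Finset V) then 1 / (p : ℝ) else 1 := by
          intro i
          by_cases hi : i ∈ ({u, v} : Finset V)
          · simp only [if_pos hi]
            have hiU : i ∈ U := by
              have : i = u ∨ i = v := by simpa using hi
              rcases this with rfl | rfl <;> assumption
            simp only [w, ← Finset.mul_sum]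
            refine mul_le_of_le_one_right (by positivity) ?_
            by_cases hex : ∃ a, e i a = c
            · obtain ⟨a, ha⟩ := hex
              rw [Finset.sum_eq_single a]
              · exact ind_le_one _
              · intro b _ hb
                exact ind_false fun h => hb (he1 i hiU (h.trans ha.symm))
              · intro h; exact absurd (mem_univ _) h
            · push Not at hex
              rw [Finset.sum_eq_zero fun a _ => ind_false (hex a)]; norm_num
          · simp only [if_neg hi, mul_one]; exact (hw.sum_one i).le
        refine (Finset.prod_le_prod ?_ fun i _ => key i).trans ?_
        · intro i _
          refine Finset.sum_nonneg fun a _ => mul_nonneg (hw.nonneg i a) ?_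
          split_ifs
          · exact ind_nonneg _
          · norm_num
        rw [Finset.prod_ite_mem, Finset.univ_inter, Finset.prod_pair hne]
        apply le_of_eq; field_simp
      · refine le_trans (b := 0) ?_ (by positivity)
        unfold Pr
        rw [show (fun ω => ind (A (u, v, c) ω)) = fun _ => (0:ℝ) from ?_, Ex_const hw]
        ext ω; exact ind_false fun h => hok h.1
    · intro j hj
      have hj := hAok j hj
      refine le_trans ?_ (le_max_right _ _)
      have hsub : (univ.filter fun i => A i ≠ (fun _ => False) ∧ ¬ Disjoint (N i) (N j)) ⊆
          M j.1 ∪ M j.2.1 := by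
        intro i hi
        obtain ⟨-, h1, h2⟩ := mem_filter.1 hi
        obtain ⟨m1, m2⟩ := hmM i (hAok i h1)
        rw [Finset.not_disjoint_iff] at h2
        obtain ⟨x, hx1, hx2⟩ := h2
        have hx : i ∈ M x := by
          simp only [N, mem_insert, mem_singleton] at hx1
          rcases hx1 with rfl | rfl
          · exact m1
          · exact m2
        simp only [N, mem_insert, mem_singleton] at hx2
        rcases hx2 with rfl | rfl
        · exact mem_union_left _ hx
        · exact mem_union_right _ hx
      refine le_trans (Nat.cast_le.2 (Finset.card_le_card hsub)) ?_
      have := Finset.card_union_le (M j.1) (M j.2.1)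
      have h2 : ((M j.1 ∪ M j.2.1).card : ℝ) ≤ (M j.1).card + (M j.2.1).card := by
        exact_mod_cast this
      linarith [hM _ hj.2.1, hM _ hj.2.2.1]
    · rcases max_cases (1:ℝ) (4 * (p * T)) with ⟨h, -⟩ | ⟨h, -⟩
      · rw [h, mul_one, mul_one_div, div_le_one (by positivity)]; nlinarith
      · rw [h]
        have : 4 * (1 / (p:ℝ) ^ 2) * (4 * (p * T)) = 16 * T / p := by field_simp; ring
        rw [this, div_le_one hp0]; linarith
  -- make a coloring
  have hω' : ∀ j, ¬ A j ω := fun j h => hω j (Or.inl h)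
  refine ⟨fun v => e v (ω v), fun v hv => hPL v (he2 v hv _), fun u hu v hv huv heq => ?_⟩
  refine hω' (u, v, e v (ω v)) ⟨⟨huv, hu, hv, ?_, he2 v hv _⟩, heq, rfl⟩
  have := he2 u hu (ω u)
  have heq' : e u (ω u) = e v (ω v) := heq
  rwa [heq'] at this
end fin

set_option maxHeartbeats 1000000 in
lemma iterate_main {V K : Type} [Fintype V] [Fintype K] [Nonempty K] (G : SimpleGraph V) (Δ : ℕ)
    (k β pm ρ : ℝ) (hsp : LocallySparse G k) (hΔ : ∀ v, G.degree v ≤ Δ)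
    (hβ0 : 0 < β) (hβ : β ≤ 1 / 10000) (hpm : 2 ≤ pm) (hk : 64 * k ≤ β * pm ^ 2)
    (hρ : 1 ≤ ρ) (hρp : 2 * ρ ≤ β ^ 2 * pm)
    (hL : 4 * ((Δ + Fintype.card K + 7) * Real.exp (-(β ^ 4 * pm / (8 * ρ ^ 2))))
      * ((Δ + 1 : ℕ) ^ 4 : ℕ) ≤ 1) (j : ℕ) :
    ∀ (p : ℕ) (T : ℝ) (U : Finset V) (L : V → Finset K),
      pm ≤ p * (1 - β - 1616 * β ^ 2) ^ j → 0 < T → T ≤ (1 / 16 + j * (β - 160 * β ^ 2)) * p →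
      T ≤ ρ * p → (∀ u, u ∉ U → L u = ∅) →
      (∀ v ∈ U, ∀ c ∈ L v, ((nbc G L v c).card : ℝ) ≤ T) →
      (∀ v ∈ U, (p : ℝ) * T ≤ ∑ c ∈ L v, (T - ((nbc G L v c).card : ℝ))) → Cb G U L := by
  have hμ0 : 0 < 1 - β - 1616 * β ^ 2 := by nlinarith
  have hμ1 : 1 - β - 1616 * β ^ 2 ≤ 1 := by nlinarith [sq_nonneg β]
  have hp_of : ∀ (p : ℕ) (j : ℕ), pm ≤ p * (1 - β - 1616 * β ^ 2) ^ j → pm ≤ p := by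
    intro p j h
    refine h.trans (mul_le_of_le_one_right (Nat.cast_nonneg _) (pow_le_one₀ hμ0.le hμ1))
  induction j with
  | zero =>
    intro p T U L h1 hT0 hT hTρ hLU hD hS
    have hp := hp_of p 0 h1
    refine final_LLL G U L p T ?_ hT0 ?_ hD hS
    · exact_mod_cast hpm.trans hp
    · push_cast at hT; linarith
  | succ j ih =>
    intro p T U L h1 hT0 hT hTρ hLU hD hS
    have hp := hp_of p _ h1
    by_cases hTp : T ≤ p / 16
    · exact final_LLL G U L p T (by exact_mod_cast hpm.trans hp) hT0 hTp hD hS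
    push Not at hTp
    obtain ⟨P, hPL, hPc⟩ := choose_P hT0 hS
    have hp0 : (0:ℝ) < p := by linarith
    let S : Ctx V K :=
      { G := G, U := U, L := L, P := P, p := p, T := T, β := β, k := k, Δ := Δ
        hβ0 := hβ0
        hβ := by linarith
        hp := by
          have : (1:ℝ) ≤ p := by linarith
          exact_mod_cast this
        hT := hTp.le
        hLU := hLU, hPL := hPL, hPc := hPc, hD := hD, hS := hS
        hk := by
          have h2 : pm ^ 2 ≤ p ^ 2 := by gcongr
          have h3 : β * pm ^ 2 ≤ β * p ^ 2 := by gcongr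
          have h4 : β * p * (p / 16) ≤ β * p * T := by gcongr
          nlinarith
        hsp := hsp, hΔ := hΔ }
    have t1 : S.tau * T = β ^ 2 * p := S.tauT
    have t2 : S.eta * T = β * p := S.etaT
    have t3 : S.tau ≤ 16 * β ^ 2 := S.tau_le
    have t4 : 0 < S.tau := S.tau_pos
    have t5 : S.kap = 1 - β := rfl
    have t6 : S.Tn = S.kap * T * (1 - S.eta + 50 * S.tau) := rfl
    have t7 : 0 < S.Tn := S.Tn_pos
    have hk0 : 0 < S.kap := S.kap_pos
    have step := S.step ρ hρ hTρ
    have hLS : 4 * ((S.Δ + Fintype.card K + 7) * Real.exp (-(S.β ^ 4 * S.p / (8 * ρ ^ 2))))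
      * ((S.Δ + 1 : ℕ) ^ 4 : ℕ) ≤ 1 := by
      refine le_trans ?_ hL
      show 4 * ((Δ + Fintype.card K + 7) * Real.exp (-(β ^ 4 * p / (8 * ρ ^ 2))))
        * ((Δ + 1 : ℕ) ^ 4 : ℕ) ≤ _
      gcongr
    have hτρ : β ^ 2 ≤ S.tau * ρ := by
      have : β ^ 2 * p ≤ (S.tau * ρ) * p := by
        rw [← t1, mul_assoc]; gcongr
      exact le_of_mul_le_mul_right this hp0
    set τ := S.tau
    set η := S.eta
    set κ := S.kap
    have hκτ : 1 ≤ κ * τ * p := by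
      have a1 : 2 * ρ ≤ β ^ 2 * p := hρp.trans (by gcongr)
      have a2 : 2 * ρ ≤ (τ * ρ) * p := a1.trans (by gcongr)
      have a3 : 2 ≤ τ * p := by
        have : 2 * ρ ≤ (τ * p) * ρ := by linarith
        exact le_of_mul_le_mul_right this (by linarith)
      have : 1 / 2 ≤ κ := by rw [t5]; linarith
      calc (1:ℝ) = 1 / 2 * 2 := by norm_num
        _ ≤ κ * (τ * p) := by gcongr
        _ = _ := by ring
    have h100 : 0 ≤ 1 - 101 * τ := by nlinarith
    set p' := ⌊κ * (1 - 100 * τ) * p⌋₊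
    have hp'1 : (p' : ℝ) ≤ κ * (1 - 100 * τ) * p := by
      refine Nat.floor_le ?_
      have : 0 ≤ 1 - 100 * τ := by linarith
      positivity
    have hp'2 : κ * (1 - 101 * τ) * p ≤ p' := by
      have := Nat.lt_floor_add_one (κ * (1 - 100 * τ) * p)
      have h3 : κ * (1 - 101 * τ) * p = κ * (1 - 100 * τ) * p - κ * τ * p := by ring
      rw [h3]
      linarith
    obtain ⟨U', L', a1, a2, a3, a4⟩ := step p' hp'1 hLS
    apply a4
    have hTn : S.Tn ≤ κ * (1 - 101 * τ) * (T - (β - 160 * β ^ 2) * p) := by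
      rw [t6]
      have : T * (1 - η + 50 * τ) ≤ (1 - 101 * τ) * (T - (β - 160 * β ^ 2) * p) := by
        have b0 : 0 ≤ τ * ((β - 160 * β ^ 2) * p) := by
          have : 0 ≤ β - 160 * β ^ 2 := by nlinarith
          positivity
        have b1 : 0 ≤ β ^ 2 * p := by positivity
        have e1 : T * (1 - η + 50 * τ) = T - β * p + 50 * (β ^ 2 * p) := by
          linear_combination (-1) * t2 + 50 * t1
        have e2 : (1 - 101 * τ) * (T - (β - 160 * β ^ 2) * p) = T - 101 * (β ^ 2 * p) - β * p
            + 160 * (β ^ 2 * p) + 101 * (τ * ((β - 160 * β ^ 2) * p)) := by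
          linear_combination (-101) * t1
        rw [e1, e2]; linarith
      calc κ * T * (1 - η + 50 * τ) = κ * (T * (1 - η + 50 * τ)) := by ring
        _ ≤ κ * ((1 - 101 * τ) * (T - (β - 160 * β ^ 2) * p)) := by gcongr
        _ = _ := by ring
    have hc0 : 0 ≤ κ * (1 - 101 * τ) := by positivity
    refine ih p' S.Tn U' L' ?_ t7 ?_ ?_ a1 a2 a3
    · have hμ : (1 - β - 1616 * β ^ 2) * p ≤ p' := by
        refine le_trans ?_ hp'2
        gcongr
        rw [t5]
        have : 101 * τ ≤ 1616 * β ^ 2 := by linarith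
        nlinarith
      refine h1.trans ?_
      rw [pow_succ']
      calc (p:ℝ) * ((1 - β - 1616 * β ^ 2) * (1 - β - 1616 * β ^ 2) ^ j)
          = ((1 - β - 1616 * β ^ 2) * p) * (1 - β - 1616 * β ^ 2) ^ j := by ring
        _ ≤ _ := by gcongr
    · refine hTn.trans ?_
      have hb' : 0 ≤ β - 160 * β ^ 2 := by nlinarith
      have : T - (β - 160 * β ^ 2) * p ≤ (1 / 16 + j * (β - 160 * β ^ 2)) * p := by
        push_cast at hT
        nlinarith
      calc κ * (1 - 101 * τ) * (T - (β - 160 * β ^ 2) * p)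
          ≤ κ * (1 - 101 * τ) * ((1 / 16 + j * (β - 160 * β ^ 2)) * p) := by gcongr
        _ = (1 / 16 + j * (β - 160 * β ^ 2)) * (κ * (1 - 101 * τ) * p) := by ring
        _ ≤ _ := by gcongr
    · refine hTn.trans ?_
      have hb' : 0 ≤ (β - 160 * β ^ 2) * p := mul_nonneg (by nlinarith) hp0.le
      calc κ * (1 - 101 * τ) * (T - (β - 160 * β ^ 2) * p)
          ≤ κ * (1 - 101 * τ) * (ρ * p) := by gcongr; linarith
        _ = ρ * (κ * (1 - 101 * τ) * p) := by ring
        _ ≤ _ := by gcongr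

lemma choose_ratio (q s : ℕ) (hsq : s ≤ q) (j : ℕ) (hj : j ≤ s) :
    ((q - j).choose (s - j) : ℝ) * (q : ℝ) ^ j ≤ (q.choose s : ℝ) * (s : ℝ) ^ j := by
  induction j with
  | zero => simp
  | succ j ih =>
    have ih := ih (by omega)
    obtain ⟨a, ha⟩ : ∃ a, q - j = a + 1 := ⟨q - j - 1, by omega⟩
    obtain ⟨b, hb⟩ : ∃ b, s - j = b + 1 := ⟨s - j - 1, by omega⟩
    have ha' : q - (j + 1) = a := by omega
    have hb' : s - (j + 1) = b := by omega
    rw [ha, hb] at ih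
    rw [ha', hb']
    have h1 : ((a + 1 : ℕ) : ℝ) * a.choose b = (a + 1).choose (b + 1) * ((b + 1 : ℕ) : ℝ) := by
      exact_mod_cast Nat.add_one_mul_choose_eq a b
    have hqa : (q : ℝ) = a + 1 + j := by
      have : q = a + 1 + j := by omega
      exact_mod_cast this
    have hsb : (s : ℝ) = b + 1 + j := by
      have : s = b + 1 + j := by omega
      exact_mod_cast this
    have hab : (b : ℝ) ≤ a := by
      have : b ≤ a := by omega
      exact_mod_cast this
    push_cast at h1
    have ha0 : (0:ℝ) < a + 1 := by positivity
    have hj0 : (0:ℝ) ≤ j := by positivity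
    have h2 : (a.choose b : ℝ) * q ≤ (a + 1).choose (b + 1) * s := by
      have : (a.choose b : ℝ) = (a + 1).choose (b + 1) * (b + 1) / (a + 1) := by
        rw [eq_div_iff ha0.ne']; linarith
      rw [this, div_mul_eq_mul_div, div_le_iff₀ ha0, mul_assoc, mul_assoc]
      refine mul_le_mul_of_nonneg_left ?_ (Nat.cast_nonneg _)
      rw [hqa, hsb]; nlinarith
    calc (a.choose b : ℝ) * (q : ℝ) ^ (j + 1) = (a.choose b * q) * (q : ℝ) ^ j := by ring
      _ ≤ ((a + 1).choose (b + 1) * s) * (q : ℝ) ^ j := by gcongr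
      _ = ((a + 1).choose (b + 1) * (q : ℝ) ^ j) * s := by ring
      _ ≤ ((q.choose s : ℝ) * (s : ℝ) ^ j) * s := by gcongr
      _ = _ := by ring

lemma count_super (A J : Finset ℕ) (s : ℕ) (hJ : J ⊆ A) :
    ((A.powersetCard s).filter fun S => J ⊆ S).card ≤ (A.card - J.card).choose (s - J.card) := by
  rw [← Finset.card_sdiff_of_subset hJ, ← Finset.card_powersetCard]
  refine Finset.card_le_card_of_injOn (fun S => S \ J) ?_ ?_
  · intro S hS
    have hS : S ∈ (A.powersetCard s).filter fun S => J ⊆ S := hS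
    rw [mem_filter, mem_powersetCard] at hS
    show S \ J ∈ ((A \ J).powersetCard (s - J.card))
    rw [mem_powersetCard]
    refine ⟨Finset.sdiff_subset_sdiff hS.1.1 (Finset.Subset.refl _), ?_⟩
    rw [Finset.card_sdiff_of_subset hS.2, hS.1.2]
  · intro S hS S' hS' h
    have hS : S ∈ (A.powersetCard s).filter fun S => J ⊆ S := hS
    have hS' : S' ∈ (A.powersetCard s).filter fun S => J ⊆ S := hS'
    have h : S \ J = S' \ J := h
    rw [← Finset.sdiff_union_of_subset (mem_filter.1 hS).2, h,
      Finset.sdiff_union_of_subset (mem_filter.1 hS').2]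

lemma mgf_set (q s : ℕ) (hq : 0 < q) (hsq : s ≤ q) (y : ℝ) (hy : 0 ≤ y) (B : Finset ℕ)
    (hB : B ∈ (Icc 1 q).powersetCard s) :
    ∑ S ∈ (Icc 1 q).powersetCard s, (1 + y) ^ (S ∩ B).card
      ≤ (q.choose s : ℝ) * Real.exp (y * (s ^ 2 / q)) := by
  rw [mem_powersetCard] at hB
  have hq0 : (0:ℝ) < q := by exact_mod_cast hq
  have e1 : ∀ F : Finset ℕ, (1 + y) ^ F.card = ∑ J ∈ F.powerset, y ^ J.card := by
    intro F
    have := Finset.prod_add (fun _ => y) (fun _ => (1:ℝ)) F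
    simp only [Finset.prod_const, one_pow, mul_one] at this
    rw [← this, add_comm]
  have e2 : ∑ S ∈ (Icc 1 q).powersetCard s, (1 + y) ^ (S ∩ B).card
      = ∑ J ∈ B.powerset, ∑ S ∈ ((Icc 1 q).powersetCard s).filter (fun S => J ⊆ S), y ^ J.card := by
    rw [Finset.sum_congr rfl fun S _ => e1 (S ∩ B)]
    refine Finset.sum_comm' ?_
    intro S J
    simp only [mem_powerset, mem_filter, Finset.subset_inter_iff]
    tauto
  rw [e2]
  have e3 : ∀ J ∈ B.powerset, ∑ S ∈ ((Icc 1 q).powersetCard s).filter (fun S => J ⊆ S), y ^ J.card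
      ≤ (q.choose s : ℝ) * (y * (s / q)) ^ J.card := by
    intro J hJ
    rw [mem_powerset] at hJ
    rw [Finset.sum_const, nsmul_eq_mul]
    have h1 := count_super (Icc 1 q) J s (hJ.trans hB.1)
    rw [Nat.card_Icc, Nat.add_sub_cancel] at h1
    have hjs : J.card ≤ s := by rw [← hB.2]; exact Finset.card_le_card hJ
    have h2 := choose_ratio q s hsq J.card hjs
    have h3 : ((q - J.card).choose (s - J.card) : ℝ) ≤ (q.choose s : ℝ) * (s / q) ^ J.card := by
      rw [div_pow, ← mul_div_assoc, le_div_iff₀ (by positivity)]; exact h2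
    calc _ ≤ ((q - J.card).choose (s - J.card) : ℝ) * y ^ J.card := by gcongr
      _ ≤ ((q.choose s : ℝ) * (s / q) ^ J.card) * y ^ J.card := by gcongr
      _ = _ := by rw [mul_pow]; ring
  refine (Finset.sum_le_sum e3).trans ?_
  rw [← Finset.mul_sum]
  have e4 : ∑ J ∈ B.powerset, (y * (s / q)) ^ J.card = (1 + y * ((s:ℝ) / q)) ^ s := by
    have := Finset.prod_add (fun _ => y * ((s:ℝ) / q)) (fun _ => (1:ℝ)) B
    simp only [Finset.prod_const, one_pow, mul_one] at this
    rw [← this, add_comm, hB.2]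
  rw [e4]
  gcongr
  have : 1 + y * ((s:ℝ) / q) ≤ Real.exp (y * (s / q)) := by
    rw [add_comm]; exact Real.add_one_le_exp _
  calc (1 + y * ((s:ℝ) / q)) ^ s ≤ (Real.exp (y * (s / q))) ^ s := by gcongr
    _ = _ := by rw [← Real.exp_nat_mul]; congr 1; ring

lemma bad_prob {V : Type} [Fintype V] (G : SimpleGraph V) (q s Δ : ℕ) (hq : 0 < q) (hsq : s ≤ q)
    (hΔ : ∀ v, G.degree v ≤ Δ) (δ : ℝ) (hδ : 0 < δ) (v : V) :
    Pr (fun (_ : V) (_ : ↥((Icc 1 q).powersetCard s)) => 1 / (q.choose s : ℝ))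
      (fun ω => (1 + δ) * (Δ * (s ^ 2 / q)) <
        ∑ u ∈ G.neighborFinset v, (((ω u).1 ∩ (ω v).1).card : ℝ))
      ≤ Real.exp (-(((1 + δ) * Real.log (1 + δ) - δ) * (Δ * (s ^ 2 / q)))) := by
  set X := (Icc 1 q).powersetCard s
  set w : V → ↥X → ℝ := fun _ _ => 1 / (q.choose s : ℝ)
  have hX : X.card = q.choose s := by simp [X]
  have hc0 : (0:ℝ) < q.choose s := by exact_mod_cast Nat.choose_pos hsq
  have hq0 : (0:ℝ) < q := by exact_mod_cast hq
  have hw : IsW w := by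
    constructor
    · intro i a; simp only [w]; positivity
    · intro i; simp only [w]
      rw [Finset.sum_const, nsmul_eq_mul, Finset.card_univ, Fintype.card_coe, hX]; field_simp
  have h1 : (0:ℝ) < 1 + δ := by linarith
  have hlog : 0 < Real.log (1 + δ) := Real.log_pos (by linarith)
  set M : ℝ := Δ * (s ^ 2 / q)
  have hM0 : 0 ≤ M := by positivity
  -- Markov
  have mk : Pr w (fun ω => (1 + δ) * M < ∑ u ∈ G.neighborFinset v, (((ω u).1 ∩ (ω v).1).card : ℝ))
      ≤ Ex w (fun ω => Real.exp (-(Real.log (1 + δ) * ((1 + δ) * M))) *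
        ∑ B : ↥X, ∏ i, (if i = v then ind (ω i = B) else
          if G.Adj v i then (1 + δ) ^ ((ω i).1 ∩ B.1).card else 1)) := by
    refine Ex_mono hw fun ω => ?_
    have e1 : ∑ B : ↥X, ∏ i, (if i = v then ind (ω i = B) else
          if G.Adj v i then (1 + δ) ^ ((ω i).1 ∩ B.1).card else 1)
        = ∏ u ∈ G.neighborFinset v, (1 + δ) ^ ((ω u).1 ∩ (ω v).1).card := by
      rw [Finset.sum_eq_single (ω v)]
      · have : G.neighborFinset v = univ.filter fun i => G.Adj v i := by ext i; simp
        rw [this, Finset.prod_filter]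
        refine Finset.prod_congr rfl fun i _ => ?_
        by_cases hi : i = v
        · subst hi; rw [if_pos rfl, ind_true rfl, if_neg (G.loopless.irrefl i)]
        · rw [if_neg hi]
      · intro B _ hB
        refine Finset.prod_eq_zero (mem_univ v) ?_
        rw [if_pos rfl, ind_false (Ne.symm hB)]
      · intro h; exact absurd (mem_univ _) h
    rw [e1, Finset.prod_pow_eq_pow_sum]
    by_cases hb : (1 + δ) * M < ∑ u ∈ G.neighborFinset v, (((ω u).1 ∩ (ω v).1).card : ℝ)
    · rw [ind_true hb]
      have : (1 + δ) ^ (∑ u ∈ G.neighborFinset v, ((ω u).1 ∩ (ω v).1).card) =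
          Real.exp (Real.log (1 + δ) * ∑ u ∈ G.neighborFinset v, (((ω u).1 ∩ (ω v).1).card : ℝ)) := by
        rw [mul_comm, ← Nat.cast_sum, Real.exp_nat_mul, Real.exp_log h1]
      rw [this, ← Real.exp_add]
      apply Real.one_le_exp
      have := mul_le_mul_of_nonneg_left hb.le hlog.le
      linarith
    · rw [ind_false hb]; positivity
  refine mk.trans ?_
  rw [Ex_smul, Ex_sum]
  have each : ∀ B ∈ (univ : Finset ↥X), Ex w (fun ω => ∏ i, (if i = v then ind (ω i = B) else
          if G.Adj v i then (1 + δ) ^ ((ω i).1 ∩ B.1).card else 1))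
      ≤ 1 / (q.choose s : ℝ) * Real.exp (δ * M) := by
    intro B _
    rw [Ex_prod (w := w) (fun i a => if i = v then ind (a = B) else
          if G.Adj v i then (1 + δ) ^ (a.1 ∩ B.1).card else 1)]
    have key : ∀ i, ∑ a, w i a * (if i = v then ind (a = B) else
          if G.Adj v i then (1 + δ) ^ (a.1 ∩ B.1).card else 1)
        ≤ (if i = v then 1 / (q.choose s : ℝ) else 1) *
          (if i ∈ G.neighborFinset v then Real.exp (δ * (s ^ 2 / q)) else 1) := by
      intro i
      by_cases hi : i = v
      · subst hi
        simp only [if_true]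
        rw [if_neg (by simp), mul_one, Finset.sum_eq_single B]
        · rw [ind_true rfl, mul_one]
        · intro b _ hb; rw [ind_false hb, mul_zero]
        · intro h; exact absurd (mem_univ _) h
      · simp only [if_neg hi, one_mul]
        by_cases ha : G.Adj v i
        · simp only [if_pos ha]
          rw [if_pos (by simpa using ha)]
          simp only [w]
          rw [← Finset.mul_sum, one_div_mul_eq_div, div_le_iff₀ hc0, mul_comm]
          refine le_trans (le_of_eq ?_) (mgf_set q s hq hsq δ hδ.le B.1 B.2)
          exact Finset.sum_coe_sort X (fun a => (1 + δ) ^ (a ∩ B.1).card)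
        · simp only [if_neg ha, mul_one]
          rw [if_neg (by simpa using ha)]
          exact (hw.sum_one i).le
    refine (Finset.prod_le_prod ?_ fun i _ => key i).trans ?_
    · intro i _
      refine Finset.sum_nonneg fun a _ => mul_nonneg (hw.nonneg i a) ?_
      split_ifs
      · exact ind_nonneg _
      · positivity
      · norm_num
    rw [Finset.prod_mul_distrib, Finset.prod_ite_eq', if_pos (mem_univ v), Finset.prod_ite_mem,
      Finset.univ_inter, Finset.prod_const, ← Real.exp_nat_mul,
      SimpleGraph.card_neighborFinset_eq_degree]
    refine mul_le_mul_of_nonneg_left (Real.exp_le_exp.2 ?_) (by positivity)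
    have : (G.degree v : ℝ) ≤ Δ := by exact_mod_cast hΔ v
    calc (G.degree v : ℝ) * (δ * (s ^ 2 / q)) ≤ Δ * (δ * (s ^ 2 / q)) := by gcongr
      _ = δ * M := by simp only [M]; ring
  have tot := Finset.sum_le_card_nsmul _ _ _ each
  rw [nsmul_eq_mul, Finset.card_univ, Fintype.card_coe, hX] at tot
  have e5 : (q.choose s : ℝ) * (1 / (q.choose s : ℝ) * Real.exp (δ * M)) = Real.exp (δ * M) := by
    field_simp
  rw [e5] at tot
  refine (mul_le_mul_of_nonneg_left tot (Real.exp_pos _).le).trans (le_of_eq ?_)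
  rw [← Real.exp_add]; congr 1; ring

lemma rand_part {V : Type} [Fintype V] (G : SimpleGraph V) (q s Δ n : ℕ) (hq : 0 < q) (hsq : s ≤ q)
    (hΔ : ∀ v, G.degree v ≤ Δ) (δ : ℝ) (hδ : 0 < δ) (hn : Fintype.card V = n) (hn1 : 1 ≤ n)
    (hf : 2 * Real.log n ≤ ((1 + δ) * Real.log (1 + δ) - δ) * (Δ * (s ^ 2 / q)))
    (P : (V → Finset ℕ) → Prop)
    (hP : ∀ L : V → Finset ℕ, (∀ v, L v ∈ (Icc 1 q).powersetCard s) →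
      (∀ v, ∑ u ∈ G.neighborFinset v, ((L u ∩ L v).card : ℝ) ≤ (1 + δ) * (Δ * (s ^ 2 / q))) → P L) :
    1 - 1 / (n : ℝ) ≤
      (((Finset.univ.pi fun _ : V => (Finset.Icc 1 q).powersetCard s).filter
        fun Lf => P (fun v => Lf v (Finset.mem_univ v))).card : ℝ) /
      ((Finset.univ.pi fun _ : V => (Finset.Icc 1 q).powersetCard s).card : ℝ) := by
  set X := (Icc 1 q).powersetCard s with hXdef
  have hX : X.card = q.choose s := by simp [X]
  have hc0 : (0:ℝ) < q.choose s := by exact_mod_cast Nat.choose_pos hsq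
  have hn0 : (0:ℝ) < n := by exact_mod_cast hn1
  set w : V → ↥X → ℝ := fun _ _ => 1 / (q.choose s : ℝ) with hwdef
  have hw : IsW w := by
    constructor
    · intro i a; simp only [w]; positivity
    · intro i; simp only [w]
      rw [Finset.sum_const, nsmul_eq_mul, Finset.card_univ, Fintype.card_coe, hX]; field_simp
  have hcard : ((Finset.univ.pi fun _ : V => X).card : ℝ) = (q.choose s : ℝ) ^ n := by
    rw [Finset.card_pi, Finset.prod_const, Finset.card_univ, hn, hX]; push_cast; rfl
  have hPr : Pr w (fun ω => P (fun v => (ω v).1)) = (((Finset.univ.pi fun _ : V => X).filter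
        fun Lf => P (fun v => Lf v (Finset.mem_univ v))).card : ℝ) / (q.choose s : ℝ) ^ n := by
    have e1 : ((Finset.univ.pi fun _ : V => X).filter
        fun Lf => P (fun v => Lf v (Finset.mem_univ v))).card
        = (univ.filter fun ω : V → ↥X => P (fun v => (ω v).1)).card := by
      refine (Finset.card_bij (fun ω _ => fun v _ => (ω v).1) ?_ ?_ ?_).symm
      · intro ω hω
        rw [mem_filter] at hω ⊢
        exact ⟨Finset.mem_pi.2 fun v _ => (ω v).2, hω.2⟩
      · intro ω _ ω' _ h
        funext v
        exact Subtype.ext (congrFun (congrFun h v) (mem_univ v))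
      · intro Lf hLf
        rw [mem_filter, Finset.mem_pi] at hLf
        exact ⟨fun v => ⟨Lf v (mem_univ v), hLf.1 v (mem_univ v)⟩, mem_filter.2 ⟨mem_univ _, hLf.2⟩, rfl⟩
    rw [e1, Finset.card_filter]
    unfold Pr Ex
    simp only [w, Finset.prod_const, Finset.card_univ, hn]
    rw [← Finset.mul_sum, one_div, inv_pow, mul_comm, ← div_eq_mul_inv]
    push_cast
    congr 1
  rw [hcard, ← hPr]
  have hbad : Pr w (fun ω => ∃ v ∈ (univ : Finset V), (1 + δ) * (Δ * (s ^ 2 / q)) <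
        ∑ u ∈ G.neighborFinset v, (((ω u).1 ∩ (ω v).1).card : ℝ)) ≤ 1 / n := by
    refine (Pr_exists hw _ _).trans ?_
    refine (Finset.sum_le_card_nsmul _ _ _ fun v _ => bad_prob G q s Δ hq hsq hΔ δ hδ v).trans ?_
    rw [nsmul_eq_mul, Finset.card_univ, hn]
    have : Real.exp (-(((1 + δ) * Real.log (1 + δ) - δ) * (Δ * (s ^ 2 / q))))
        ≤ Real.exp (-(2 * Real.log n)) := Real.exp_le_exp.2 (by linarith)
    have h2 : Real.exp (-(2 * Real.log n)) = 1 / (n:ℝ) ^ 2 := by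
      rw [Real.exp_neg, two_mul, Real.exp_add, Real.exp_log hn0, one_div, sq]
    rw [h2] at this
    calc (n:ℝ) * _ ≤ n * (1 / (n:ℝ) ^ 2) := mul_le_mul_of_nonneg_left this hn0.le
      _ = 1 / n := by field_simp
  have hone : (1:ℝ) ≤ Pr w (fun ω => P (fun v => (ω v).1)) + Pr w (fun ω => ∃ v ∈ (univ : Finset V),
      (1 + δ) * (Δ * (s ^ 2 / q)) <
        ∑ u ∈ G.neighborFinset v, (((ω u).1 ∩ (ω v).1).card : ℝ)) := by
    refine le_trans ?_ (Pr_or hw _ _)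
    unfold Pr
    rw [← Ex_const hw 1]
    refine Ex_mono hw fun ω => ?_
    rw [Ex_const hw 1]
    refine le_of_eq (ind_true ?_).symm
    by_cases h : ∃ v ∈ (univ : Finset V), (1 + δ) * (Δ * (s ^ 2 / q)) <
        ∑ u ∈ G.neighborFinset v, (((ω u).1 ∩ (ω v).1).card : ℝ)
    · exact Or.inr h
    · left
      push Not at h
      exact hP _ (fun v => (ω v).2) fun v => h v (mem_univ v)
  linarith

lemma mem_nbc {V K : Type} [Fintype V] {G : SimpleGraph V} {L : V → Finset K} {v u : V} {c : K} :
    u ∈ nbc G L v c ↔ G.Adj v u ∧ c ∈ L u := by simp [nbc]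

lemma det_part {V : Type} [Fintype V] (G : SimpleGraph V) (q s Δ : ℕ)
    (k β pm ρ T : ℝ) (hsp : LocallySparse G k) (hΔ : ∀ v, G.degree v ≤ Δ)
    (hβ0 : 0 < β) (hβ : β ≤ 1 / 10000) (hpm : 2 ≤ pm) (hk : 64 * k ≤ β * pm ^ 2)
    (hρ : 1 ≤ ρ) (hρp : 2 * ρ ≤ β ^ 2 * pm)
    (hL : 4 * ((Δ + (q + 1) + 7) * Real.exp (-(β ^ 4 * pm / (8 * ρ ^ 2))))
      * ((Δ + 1) ^ 4) ≤ 1) (j : ℕ)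
    (hpj : pm ≤ (s / 2 : ℕ) * (1 - β - 1616 * β ^ 2) ^ j) (hT0 : 0 < T)
    (hT : T ≤ (1 / 16 + j * (β - 160 * β ^ 2)) * (s / 2 : ℕ)) (hTρ : T ≤ ρ * (s / 2 : ℕ))
    (L : V → Finset ℕ) (hLX : ∀ v, L v ∈ (Icc 1 q).powersetCard s)
    (hsum : ∀ v, ∑ u ∈ G.neighborFinset v, ((L u ∩ L v).card : ℝ) ≤ s * T / 2) :
    ∃ φ : V → ℕ, (∀ v, φ v ∈ L v) ∧ ∀ u v, G.Adj u v → φ u ≠ φ v := by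
  have hLq : ∀ v, ∀ c ∈ L v, c < q + 1 := by
    intro v c hc
    have := (mem_powersetCard.1 (hLX v)).1 hc
    rw [Finset.mem_Icc] at this
    omega
  let L0 : V → Finset (Fin (q + 1)) := fun v => univ.filter fun c => c.1 ∈ L v
  have hmap : ∀ v, (L0 v).map Fin.valEmbedding = L v := by
    intro v
    ext c
    simp only [L0, mem_map, mem_filter, mem_univ, true_and, Fin.valEmbedding_apply]
    constructor
    · rintro ⟨a, ha, rfl⟩; exact ha
    · intro hc; exact ⟨⟨c, hLq v c hc⟩, hc, rfl⟩
  have hmem : ∀ v c, c ∈ L0 v ↔ c.1 ∈ L v := fun v c => by simp [L0]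
  have hc : ∀ v, (L0 v).card = s := by
    intro v
    rw [← Finset.card_map Fin.valEmbedding, hmap]
    exact (mem_powersetCard.1 (hLX v)).2
  have hI : ∀ u v, (L0 u ∩ L0 v).card = (L u ∩ L v).card := by
    intro u v
    rw [← Finset.card_map Fin.valEmbedding, Finset.map_inter, hmap, hmap]
  let L1 : V → Finset (Fin (q + 1)) := fun v => (L0 v).filter fun c => ((nbc G L0 v c).card : ℝ) ≤ T
  have h10 : ∀ v, L1 v ⊆ L0 v := fun v => Finset.filter_subset _ _
  have hdeg : ∀ v c, ((nbc G L1 v c).card : ℝ) ≤ (nbc G L0 v c).card := by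
    intro v c
    refine Nat.cast_le.2 (Finset.card_le_card fun u hu => ?_)
    have := mem_nbc.1 hu
    exact mem_nbc.2 ⟨this.1, h10 u this.2⟩
  have key : Cb G univ L1 := by
    refine iterate_main G Δ k β pm ρ hsp hΔ hβ0 hβ hpm hk hρ hρp ?_ j (s / 2) T univ L1 hpj hT0 hT hTρ
      ?_ ?_ ?_
    · rw [Fintype.card_fin]; push_cast; exact hL
    · intro u hu; exact absurd (mem_univ u) hu
    · intro v _ c hc
      exact (hdeg v c).trans (mem_filter.1 hc).2
    · intro v _
      have h1 : ∑ c ∈ L0 v, (T - ((nbc G L0 v c).card : ℝ)) ≤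
          ∑ c ∈ L1 v, (T - ((nbc G L1 v c).card : ℝ)) := by
        have hsf : ∑ c ∈ L1 v, (T - ((nbc G L1 v c).card : ℝ)) = ∑ c ∈ L0 v,
            if ((nbc G L0 v c).card : ℝ) ≤ T then (T - ((nbc G L1 v c).card : ℝ)) else 0 :=
          Finset.sum_filter _ _
        rw [hsf]
        refine Finset.sum_le_sum fun c _ => ?_
        split_ifs with h
        · linarith [hdeg v c]
        · linarith
      refine le_trans ?_ h1
      rw [Finset.sum_sub_distrib, Finset.sum_const, hc, nsmul_eq_mul]
      have h2 : ∑ c ∈ L0 v, ((nbc G L0 v c).card : ℝ)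
          = ∑ u ∈ G.neighborFinset v, ((L u ∩ L v).card : ℝ) := by
        have : ∀ u ∈ G.neighborFinset v, ((L u ∩ L v).card : ℝ) = ∑ c ∈ L0 u ∩ L0 v, (1:ℝ) := by
          intro u _; rw [← hI]; simp
        rw [Finset.sum_congr rfl this]
        have : ∀ c ∈ L0 v, ((nbc G L0 v c).card : ℝ) = ∑ u ∈ nbc G L0 v c, (1:ℝ) := by
          intro u _; simp
        rw [Finset.sum_congr rfl this]
        refine Finset.sum_comm' ?_
        intro c u
        rw [mem_nbc, mem_inter, SimpleGraph.mem_neighborFinset]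
        tauto
      rw [h2]
      have h3 := hsum v
      have h4 : ((s / 2 : ℕ) : ℝ) ≤ s / 2 := Nat.cast_div_le
      have h5 : ((s / 2 : ℕ) : ℝ) * T ≤ s / 2 * T := by gcongr
      linarith
  obtain ⟨φ, h1, h2⟩ := key
  refine ⟨fun v => (φ v).1, fun v => (hmem v _).1 (h10 v (h1 v (mem_univ v))), ?_⟩
  intro u v huv heq
  exact h2 u (mem_univ u) v (mem_univ v) huv (Fin.ext heq)

lemma mu_ge (δ β : ℝ) (hδ : 0 < δ) (hδ1 : δ ≤ 1) (hβ : β = δ / 10000) :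
    Real.exp (-((1 + δ) * (β - 160 * β ^ 2))) ≤ 1 - β - 1616 * β ^ 2 := by
  have hβ0 : 0 < β := by rw [hβ]; positivity
  have hβ1 : β ≤ 1 / 10000 := by rw [hβ]; linarith
  have hδβ : δ = 10000 * β := by rw [hβ]; ring
  set t := (1 + δ) * (β - 160 * β ^ 2) with ht
  have ht0 : 0 < t := by
    rw [ht]; apply mul_pos (by linarith); nlinarith
  have ht2 : t ≤ 2 * β := by rw [ht]; nlinarith [sq_nonneg β]
  have h1 : 1 + t ≤ Real.exp t := by rw [add_comm]; exact Real.add_one_le_exp t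
  rw [Real.exp_neg]
  refine (inv_anti₀ (by linarith) h1).trans ?_
  rw [inv_le_iff_one_le_mul₀ (by linarith)]
  have h2 : δ * β - 320 * β ^ 2 ≤ t - β := by rw [ht]; nlinarith [sq_nonneg β]
  have h3 : (β + 1616 * β ^ 2) * t ≤ (β + 1616 * β ^ 2) * (2 * β) := by gcongr
  have h4 : (β + 1616 * β ^ 2) * (2 * β) ≤ 3 * β ^ 2 := by nlinarith [sq_nonneg β]
  have h5 : δ * β = 10000 * β ^ 2 := by rw [hδβ]; ring
  nlinarith [sq_nonneg β]

lemma exp_big (σ M ℓ : ℝ) (hσ : 0 < σ) (hM : 0 < M) (hℓ : 24 * M / σ ^ 4 ≤ ℓ) :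
    M * ℓ ^ 3 ≤ Real.exp (σ * ℓ) := by
  have hℓ0 : 0 < ℓ := lt_of_lt_of_le (by positivity) hℓ
  have h := Real.pow_div_factorial_le_exp (σ * ℓ) (by positivity) 4
  refine le_trans ?_ h
  rw [div_le_iff₀ (by positivity)] at hℓ
  rw [show ((Nat.factorial 4 : ℕ) : ℝ) = 24 by norm_num [Nat.factorial]]
  rw [le_div_iff₀ (by norm_num)]
  calc M * ℓ ^ 3 * 24 = (24 * M) * ℓ ^ 3 := by ring
    _ ≤ (ℓ * σ ^ 4) * ℓ ^ 3 := by gcongr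
    _ = _ := by ring

lemma f_pos (δ : ℝ) (hδ : 0 < δ) : 0 < (1 + δ) * Real.log (1 + δ) - δ := by
  have h0 : 0 < 1 + δ := by linarith
  have h := Real.log_lt_sub_one_of_pos (inv_pos.2 h0) (by
    intro h; have := inv_lt_one_of_one_lt₀ (by linarith : 1 < 1 + δ); linarith)
  rw [Real.log_inv] at h
  have h2 : (1 + δ) * (1 + δ)⁻¹ = 1 := mul_inv_cancel₀ h0.ne'
  have h3 := mul_lt_mul_of_pos_left h h0
  nlinarith

/-- numeric facts -/
lemma num_facts (A δ σ β α' M ℓ ρ : ℝ) (k : ℝ) (Δ q : ℕ) (hA : 1 < A) (hδ1 : δ ≤ 1) (hδ0 : 0 < δ)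
    (hβ0 : 0 < β) (hβ1 : β ≤ 1) (hσ : 0 < σ) (hα : 0 < α') (hℓ1 : 1 ≤ ℓ) (hk : 1 ≤ k)
    (hM : M * ℓ ^ 3 ≤ Real.exp (σ * ℓ)) (hM1 : 24 ≤ M) (hM2 : 9216 / β ≤ M) (hM3 : 96 / β ^ 2 ≤ M)
    (hM4 : 10752 / (β ^ 4 * α') ≤ M) (hρ : ρ = (1 + δ) ^ 2 * ℓ / A)
    (hΔ : 100 ≤ Δ) (hΔℓ : α' * Real.log Δ ≤ ℓ) (hq : (q : ℝ) ≤ Δ) (pm : ℝ)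
    (hpm : pm = Real.sqrt k * Real.exp (σ * ℓ) / 12) :
    2 ≤ pm ∧ 64 * k ≤ β * pm ^ 2 ∧ 2 * ρ ≤ β ^ 2 * pm ∧
    (4 * ((Δ + (q + 1) + 7) * Real.exp (-(β ^ 4 * pm / (8 * ρ ^ 2)))) * ((Δ + 1) ^ 4) : ℝ) ≤ 1 := by
  have hsk : 1 ≤ Real.sqrt k := Real.one_le_sqrt.2 hk
  set E := Real.exp (σ * ℓ) with hE
  have hℓ3 : 1 ≤ ℓ ^ 3 := one_le_pow₀ hℓ1
  have hM0 : 0 < M := by linarith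
  have hME : M ≤ E := (le_mul_of_one_le_right hM0.le hℓ3).trans hM
  have hMℓ : M * ℓ ≤ E := le_trans (by
    have : ℓ ≤ ℓ ^ 3 := by nlinarith [sq_nonneg ℓ]
    gcongr) hM
  have hE0 : 0 < E := Real.exp_pos _
  have hpmE : E / 12 ≤ pm := by
    rw [hpm]
    have := le_mul_of_one_le_left hE0.le hsk
    linarith
  have hpm0 : 0 < pm := lt_of_lt_of_le (by positivity) hpmE
  have hℓ0 : 0 < ℓ := by linarith
  have hρ4 : ρ ≤ 4 * ℓ := by
    rw [hρ, div_le_iff₀ (by linarith)]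
    have h1 : (1 + δ) ^ 2 ≤ 4 := by nlinarith
    have h2 : (1 + δ) ^ 2 * ℓ ≤ 4 * ℓ := by gcongr
    nlinarith
  have hρ0 : 0 < ρ := by rw [hρ]; positivity
  refine ⟨by linarith, ?_, ?_, ?_⟩
  · rw [div_le_iff₀ hβ0] at hM2
    have h1 : pm ^ 2 = k * E ^ 2 / 144 := by
      rw [hpm, div_pow, mul_pow, Real.sq_sqrt (by linarith)]; norm_num
    rw [h1]
    have h2 : 9216 ≤ β * E := by nlinarith
    have hE1 : 1 ≤ E := by linarith
    have h3 : β * E ≤ β * E ^ 2 := by gcongr; nlinarith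
    have h4 : 9216 * k ≤ (β * E ^ 2) * k := by gcongr; linarith
    linarith
  · rw [div_le_iff₀ (by positivity)] at hM3
    have h1 : 96 * ℓ ≤ β ^ 2 * E := by
      calc 96 * ℓ ≤ (M * β ^ 2) * ℓ := by gcongr
        _ = β ^ 2 * (M * ℓ) := by ring
        _ ≤ _ := by gcongr
    have h2 : β ^ 2 * (E / 12) ≤ β ^ 2 * pm := by gcongr
    linarith
  · have hΔ1 : (100:ℝ) ≤ Δ := by exact_mod_cast hΔ
    have hΔ0 : (0:ℝ) < Δ := by linarith
    rw [div_le_iff₀ (by positivity)] at hM4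
    have key : 7 * Real.log Δ ≤ β ^ 4 * pm / (8 * ρ ^ 2) := by
      rw [le_div_iff₀ (by positivity)]
      have hlog : Real.log Δ ≤ ℓ / α' := by rw [le_div_iff₀ hα]; linarith
      have hlog0 : 0 ≤ Real.log Δ := Real.log_nonneg (by linarith)
      have e1 : 10752 * ℓ ^ 3 ≤ α' * (β ^ 4 * E) := by
        calc 10752 * ℓ ^ 3 ≤ (M * (β ^ 4 * α')) * ℓ ^ 3 := by gcongr
          _ = α' * β ^ 4 * (M * ℓ ^ 3) := by ring
          _ ≤ α' * β ^ 4 * E := by gcongr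
          _ = _ := by ring
      calc 7 * Real.log Δ * (8 * ρ ^ 2) ≤ 7 * (ℓ / α') * (8 * (4 * ℓ) ^ 2) := by gcongr
        _ = (10752 * ℓ ^ 3) / α' / 12 := by field_simp; ring
        _ ≤ (α' * (β ^ 4 * E)) / α' / 12 := by gcongr
        _ = β ^ 4 * (E / 12) := by field_simp
        _ ≤ _ := by gcongr
    have hexp : Real.exp (-(β ^ 4 * pm / (8 * ρ ^ 2))) ≤ 1 / (Δ:ℝ) ^ 7 := by
      have : Real.exp (-(β ^ 4 * pm / (8 * ρ ^ 2))) ≤ Real.exp (-(7 * Real.log Δ)) :=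
        Real.exp_le_exp.2 (by linarith)
      refine this.trans (le_of_eq ?_)
      rw [Real.exp_neg, one_div]
      congr 1
      have := Real.exp_nat_mul (Real.log Δ) 7
      rw [Real.exp_log hΔ0] at this
      exact_mod_cast this
    have h3 : (Δ : ℝ) + (q + 1) + 7 ≤ 3 * Δ := by linarith
    have h4 : ((Δ : ℝ) + 1) ^ 4 ≤ (2 * Δ) ^ 4 := by gcongr; linarith
    calc (4 * ((Δ + (q + 1) + 7) * Real.exp (-(β ^ 4 * pm / (8 * ρ ^ 2)))) * ((Δ + 1) ^ 4) : ℝ)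
        ≤ 4 * ((3 * Δ) * (1 / (Δ:ℝ) ^ 7)) * (2 * Δ) ^ 4 := by gcongr
      _ = 192 / Δ ^ 2 := by field_simp; ring
      _ ≤ 1 := by rw [div_le_one (by positivity)]; nlinarith

set_option maxHeartbeats 4000000 in
lemma core (A δ σ α' : ℝ) (hA : 1 < A) (hδ0 : 0 < δ) (hδ1 : δ ≤ 1) (hσ : 0 < σ)
    (hσA : (1 + δ) ^ 3 ≤ (1 - σ) * A) (hα : 0 < α') :
    ∃ ℓ0 : ℝ, ∀ (Δ n q s : ℕ) (k ℓ : ℝ), 100 ≤ Δ → ℓ0 ≤ ℓ → α' * Real.log Δ ≤ ℓ → 1 ≤ k →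
      (q : ℝ) = 4 * A * Δ / ℓ → s ≤ q → Real.sqrt k * Real.exp ℓ ≤ s → Real.log n ≤ (s : ℝ) ^ 2 →
      ∀ (V : Type) [Fintype V] (G : SimpleGraph V),
        Fintype.card V = n → 1 ≤ n →
        (∀ v : V, G.degree v ≤ Δ) →
        LocallySparse G k →
        1 - 1 / (n : ℝ) ≤
          (((Finset.univ.pi fun _ : V => (Finset.Icc 1 q).powersetCard s).filter
                fun Lf => ∃ φ : V → ℕ,
                  (∀ v : V, φ v ∈ Lf v (Finset.mem_univ v)) ∧
                  ∀ u v : V, G.Adj u v → φ u ≠ φ v).card : ℝ) /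
            ((Finset.univ.pi fun _ : V => (Finset.Icc 1 q).powersetCard s).card : ℝ) := by
  have hf := f_pos δ hδ0
  set f := (1 + δ) * Real.log (1 + δ) - δ with hfdef
  set β := δ / 10000 with hβ
  have hβ0 : 0 < β := by positivity
  have hβ1 : β ≤ 1 / 10000 := by rw [hβ]; linarith
  set M := 24 + 9216 / β + 96 / β ^ 2 + 10752 / (β ^ 4 * α') with hM
  have m1 : 0 < 9216 / β := by positivity
  have m2 : 0 < 96 / β ^ 2 := by positivity
  have m3 : 0 < 10752 / (β ^ 4 * α') := by positivity
  have hM0 : 0 < M := by linarith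
  have M1 : 24 ≤ M := by linarith
  have M2 : 9216 / β ≤ M := by linarith
  have M3 : 96 / β ^ 2 ≤ M := by linarith
  have M4 : 10752 / (β ^ 4 * α') ≤ M := by linarith
  clear_value f β M
  clear hM m1 m2 m3
  refine ⟨24 * M / σ ^ 4 + 4 * A + 8 * A / f + 2 / δ + 1, ?_⟩
  intro Δ n q s k ℓ hΔ hℓ hΔℓ hk hq hsq hs hlogn V _ G hcard hn1 hdeg hsp
  have a1 : 0 < 24 * M / σ ^ 4 := by positivity
  have a2 : 0 < 8 * A / f := by positivity
  have a3 : 0 < 2 / δ := by positivity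
  have hℓ1 : 1 ≤ ℓ := by linarith
  have hℓ0 : 0 < ℓ := by linarith
  have hℓA : 4 * A ≤ ℓ := by linarith
  have hΔ0 : (0:ℝ) < Δ := by exact_mod_cast (by omega : 0 < Δ)
  have hME := exp_big σ M ℓ hσ hM0 (by linarith)
  have hsk : 1 ≤ Real.sqrt k := Real.one_le_sqrt.2 hk
  have hqR : (0:ℝ) < q := by rw [hq]; positivity
  have hq0 : 0 < q := by exact_mod_cast hqR
  have hqΔ : (q:ℝ) ≤ Δ := by
    rw [hq, div_le_iff₀ hℓ0, mul_comm (Δ:ℝ) ℓ]; exact mul_le_mul_of_nonneg_right hℓA hΔ0.le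
  set ρ := (1 + δ) ^ 2 * ℓ / A with hρ
  set pm := Real.sqrt k * Real.exp (σ * ℓ) / 12 with hpm
  obtain ⟨n1, n2, n3, n4⟩ := num_facts A δ σ β α' M ℓ ρ k Δ q hA hδ1 hδ0 hβ0 (by linarith) hσ hα hℓ1 hk
    hME M1 M2 M3 M4 hρ hΔ hΔℓ hqΔ pm hpm
  clear_value ρ pm
  have hρ1 : 1 ≤ ρ := by
    rw [hρ, le_div_iff₀ (by linarith)]
    have : 1 ≤ (1 + δ) ^ 2 := one_le_pow₀ (by linarith)
    have h2 : ℓ ≤ (1 + δ) ^ 2 * ℓ := le_mul_of_one_le_left hℓ0.le this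
    linarith
  have hsℓ : ℓ ≤ s := by
    refine le_trans ?_ hs
    have h1 : ℓ ≤ Real.exp ℓ := by linarith [Real.add_one_le_exp ℓ]
    exact h1.trans (le_mul_of_one_le_left (Real.exp_pos _).le hsk)
  have hs0 : (0:ℝ) < s := by linarith
  have hp0 : (s:ℝ) ≤ 2 * (s / 2 : ℕ) + 1 := by
    have : s ≤ 2 * (s / 2) + 1 := by omega
    exact_mod_cast this
  set p0 : ℝ := ((s / 2 : ℕ) : ℝ) with hp0def
  have hp1 : (s:ℝ) / 2 ≤ (1 + δ) * p0 := by
    have : 2 ≤ δ * s := by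
      have : 2 / δ ≤ s := by linarith
      rw [div_le_iff₀ hδ0] at this; linarith
    have h5 : δ * s ≤ δ * (2 * p0 + 1) := mul_le_mul_of_nonneg_left hp0 hδ0.le
    linarith
  have hp00 : 0 ≤ p0 := Nat.cast_nonneg _
  have hp2 : (s:ℝ) / 4 ≤ p0 := by
    have h5 : δ * p0 ≤ 1 * p0 := mul_le_mul_of_nonneg_right hδ1 hp00
    linarith
  set β' := β - 160 * β ^ 2 with hβ'
  have hb' : 0 < β' := by
    have h5 : β * β ≤ 1 / 10000 * β := mul_le_mul_of_nonneg_right hβ1 hβ0.le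
    rw [hβ', pow_two]; linarith
  set T := (1 + δ) * s * ℓ / (2 * A) with hT
  have hTρ : T ≤ ρ * p0 := by
    calc T = (1 + δ) * ℓ / A * (s / 2) := by rw [hT]; field_simp
      _ ≤ (1 + δ) * ℓ / A * ((1 + δ) * p0) := by gcongr
      _ = ρ * p0 := by rw [hρ]; ring
  set j := ⌈ρ / β'⌉₊ with hj
  have hj1 : ρ ≤ j * β' := by
    have := Nat.le_ceil (ρ / β')
    rwa [div_le_iff₀ hb'] at this
  have hj2 : j * β' ≤ ρ + β' := by
    have := (Nat.ceil_lt_add_one (a := ρ / β') (by positivity)).le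
    calc j * β' ≤ (ρ / β' + 1) * β' := by gcongr
      _ = _ := by field_simp
  have hμ := mu_ge δ β hδ0 hδ1 hβ
  have hsd : (Δ:ℝ) * ((s:ℝ) ^ 2 / q) = s ^ 2 * ℓ / (4 * A) := by
    rw [hq]; field_simp
  refine rand_part G q s Δ n hq0 hsq hdeg δ hδ0 hcard hn1 ?_ (fun L => ∃ φ : V → ℕ,
    (∀ v : V, φ v ∈ L v) ∧ ∀ u v : V, G.Adj u v → φ u ≠ φ v) ?_
  · rw [hsd, ← hfdef]
    have h1 : 8 * A / f ≤ ℓ := by linarith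
    rw [div_le_iff₀ hf] at h1
    have hlog0 : 0 ≤ Real.log n := Real.log_nonneg (by exact_mod_cast hn1)
    calc 2 * Real.log n ≤ 2 * (s:ℝ) ^ 2 := by linarith
      _ = (8 * A) * s ^ 2 / (4 * A) := by field_simp; ring
      _ ≤ (ℓ * f) * s ^ 2 / (4 * A) := by gcongr
      _ = _ := by ring
  · intro L hLX hsum
    refine det_part G q s Δ k β pm ρ T hsp hdeg hβ0 hβ1 n1 n2 hρ1 n3 n4 j ?_ (by positivity) ?_ hTρ
      L hLX ?_
    · have e1 : Real.exp (-((1 + δ) * β')) ^ j ≤ (1 - β - 1616 * β ^ 2) ^ j := by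
        gcongr
      rw [← Real.exp_nat_mul] at e1
      have e2 : -((1 - σ) * ℓ) - 1 ≤ (j:ℝ) * (-((1 + δ) * β')) := by
        have h1 : (1 + δ) * (j * β') ≤ (1 + δ) * (ρ + β') := by gcongr
        have h2 : (1 + δ) * ρ ≤ (1 - σ) * ℓ := by
          have : (1 + δ) * ρ = (1 + δ) ^ 3 * ℓ / A := by rw [hρ]; ring
          rw [this, div_le_iff₀ (by linarith)]
          calc (1 + δ) ^ 3 * ℓ ≤ ((1 - σ) * A) * ℓ := by gcongr
            _ = _ := by ring
        have h3 : (1 + δ) * β' ≤ 1 := by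
          have : β' ≤ 1 / 2 := by rw [hβ']; linarith [sq_nonneg β]
          have h5 : δ * β' ≤ 1 * β' := mul_le_mul_of_nonneg_right hδ1 hb'.le
          linarith
        linarith
      have e3 := (Real.exp_le_exp.2 e2).trans e1
      have e4 : Real.exp (σ * ℓ) / 3 ≤ Real.exp ℓ * Real.exp (-((1 - σ) * ℓ) - 1) := by
        rw [← Real.exp_add, show ℓ + (-((1 - σ) * ℓ) - 1) = σ * ℓ - 1 by ring, Real.exp_sub]
        have := Real.exp_one_lt_three.le
        gcongr
      calc pm = Real.sqrt k / 4 * (Real.exp (σ * ℓ) / 3) := by rw [hpm]; ring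
        _ ≤ Real.sqrt k / 4 * (Real.exp ℓ * Real.exp (-((1 - σ) * ℓ) - 1)) := by gcongr
        _ = (Real.sqrt k * Real.exp ℓ) / 4 * Real.exp (-((1 - σ) * ℓ) - 1) := by ring
        _ ≤ s / 4 * Real.exp (-((1 - σ) * ℓ) - 1) := by gcongr
        _ ≤ p0 * (1 - β - 1616 * β ^ 2) ^ j := by gcongr
    · refine hTρ.trans ?_
      have : ρ ≤ 1 / 16 + j * β' := by linarith
      gcongr
    · intro v
      refine (hsum v).trans (le_of_eq ?_)
      rw [hsd, hT]; field_simp; ring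

/-- Palette sparsification for locally sparse graphs: sampling `s` colors per vertex uniformly
from `[q] = {1, …, q}` yields, with probability at least `1 - 1/n`, lists admitting a proper
coloring.  Probabilities are expressed by counting outcomes of the (uniform) product sample
space `Ω = Π_v {L ⊆ [q] : |L| = s}`. -/
theorem stmt2 (ε γ : ℝ) (hε : 0 < ε) (hγ : γ ∈ Set.Ioo (0 : ℝ) 1) :
    ∃ C : ℝ, 0 < C ∧ ∀ α : ℝ, α ∈ Set.Ioo (0 : ℝ) 1 →
    ∃ Δ₀ : ℕ, ∀ Δ : ℕ, Δ₀ ≤ Δ → ∀ (n : ℕ) (k : ℝ) (q s : ℕ),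
      1 ≤ k → k ≤ (Δ : ℝ) ^ (2 * α * γ) →
      (q : ℝ) = 4 * (1 + γ + ε) * Δ / Real.log ((Δ : ℝ) ^ α / Real.sqrt k) →
      s ≤ q →
      (Δ : ℝ) ^ α + C * Real.sqrt (Real.log n) ≤ (s : ℝ) →
      ∀ (V : Type) [Fintype V] (G : SimpleGraph V),
        Fintype.card V = n →
        (∀ v : V, G.degree v ≤ Δ) →
        LocallySparse G k →
        1 - 1 / (n : ℝ) ≤
          (((Finset.univ.pi fun _ : V => (Finset.Icc 1 q).powersetCard s).filter
                fun Lf => ∃ φ : V → ℕ,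
                  (∀ v : V, φ v ∈ Lf v (Finset.mem_univ v)) ∧
                  ∀ u v : V, G.Adj u v → φ u ≠ φ v).card : ℝ) /
            ((Finset.univ.pi fun _ : V => (Finset.Icc 1 q).powersetCard s).card : ℝ) := by
  obtain ⟨hγ0, hγ1⟩ := hγ
  refine ⟨1, one_pos, ?_⟩
  rintro α ⟨hα0, hα1⟩
  have hA : 1 < 1 + γ + ε := by linarith
  obtain ⟨δ, hδ0, hδ1, hδ2⟩ : ∃ δ : ℝ, 0 < δ ∧ δ ≤ 1 ∧ δ ≤ (γ + ε) / 14 :=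
    ⟨min 1 ((γ + ε) / 14), lt_min one_pos (by linarith), min_le_left _ _, min_le_right _ _⟩
  have hα' : 0 < α * (1 - γ) := mul_pos hα0 (by linarith)
  obtain ⟨ℓ0, h⟩ := core (1 + γ + ε) δ (((γ + ε) / 2) / (1 + γ + ε)) (α * (1 - γ)) hA hδ0 hδ1
    (div_pos (by linarith) (by linarith)) (by
      rw [sub_mul, div_mul_cancel₀ _ (by linarith)]
      have : (1 + δ) ^ 3 ≤ 1 + 7 * δ := by
        have h1 : δ ^ 2 ≤ δ := by nlinarith
        have h2 : δ ^ 3 ≤ δ := by nlinarith [pow_pos hδ0 2]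
        nlinarith
      linarith) hα'
  refine ⟨max 100 ⌈Real.exp (ℓ0 / (α * (1 - γ)))⌉₊, ?_⟩
  intro Δ hΔ n k q s hk hkΔ hq hsq hs V _ G hcard hdeg hsp
  rcases Nat.eq_zero_or_pos n with hn | hn
  · subst hn
    have hE : ∀ v : V, False := fun v => (Fintype.card_eq_zero_iff.1 hcard).false v
    rw [Finset.filter_true_of_mem (fun Lf _ =>
      ⟨fun _ => 0, fun v => (hE v).elim, fun v => (hE v).elim⟩)]
    rw [Finset.card_pi, Finset.prod_eq_one (fun v _ => (hE v).elim)]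
    simp
  · have h100 : 100 ≤ Δ := (le_max_left _ _).trans hΔ
    have hΔe : Real.exp (ℓ0 / (α * (1 - γ))) ≤ Δ :=
      (Nat.le_ceil _).trans (by exact_mod_cast (le_max_right _ _).trans hΔ)
    have hΔ0 : (0:ℝ) < Δ := by exact_mod_cast (by omega : 0 < Δ)
    have hk0 : 0 < k := by linarith
    have hsk0 : 0 < Real.sqrt k := Real.sqrt_pos.2 hk0
    have hp0 : 0 < (Δ:ℝ) ^ α := Real.rpow_pos_of_pos hΔ0 _
    have hlogk : Real.log k ≤ 2 * α * γ * Real.log Δ := by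
      rw [← Real.log_rpow hΔ0]; exact Real.log_le_log hk0 hkΔ
    have hℓ : α * (1 - γ) * Real.log Δ ≤ Real.log ((Δ : ℝ) ^ α / Real.sqrt k) := by
      rw [Real.log_div hp0.ne' hsk0.ne', Real.log_rpow hΔ0, Real.log_sqrt hk0.le]
      linarith
    have hℓ0 : ℓ0 ≤ α * (1 - γ) * Real.log Δ := by
      have := (Real.le_log_iff_exp_le hΔ0).2 hΔe
      rw [div_le_iff₀ hα'] at this
      linarith
    have hlog0 : 0 ≤ Real.log n := Real.log_nonneg (by exact_mod_cast hn)
    refine h Δ n q s k _ h100 (hℓ0.trans hℓ) hℓ hk hq hsq ?_ ?_ V G hcard hn hdeg hsp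
    · rw [Real.exp_log (div_pos hp0 hsk0), mul_div_cancel₀ _ hsk0.ne']
      linarith [Real.sqrt_nonneg (Real.log n)]
    · have h1 : Real.sqrt (Real.log n) ≤ s := by linarith
      calc Real.log n = Real.sqrt (Real.log n) ^ 2 := (Real.sq_sqrt hlog0).symm
        _ ≤ _ := by gcongr
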